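/- arXiv:2104.10958 — 4 statements merged into one kernel-verified Lean document; each statement's English description precedes it below -/
import Mathlib

section
/- For every natural number h with h ≥ 9 (equivalently, for every odd integer g = 2h+1 ≥ 19), the symplectic group Sp(2h; Z/2Z) is generated by two elements; that is, there exist two matrices S, T in Sp(2h; Z/2Z) such that the subgroup of Sp(2h; Z/2Z) generated by {S, T} is the whole group. -/
namespace Symplectic

open Matrix

section Transvection

variable {l : Type*} [Fintype l] [DecidableEq l]

/-- The standard symplectic form over `ZMod 2`. -/
abbrev form (l : Type*) [Fintype l] [DecidableEq l] :
    LinearMap.BilinForm (ZMod 2) (l ⊕ l → ZMod 2) :=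
  Matrix.toBilin' (J l (ZMod 2))

theorem form_apply (x y : l ⊕ l → ZMod 2) :
    form l x y = ∑ i, (x (.inl i) * y (.inr i) + x (.inr i) * y (.inl i)) := by
  simp [form, Matrix.toBilin'_apply', J, dotProduct, Matrix.fromBlocks_mulVec,
    Fintype.sum_sum_type, Finset.sum_add_distrib, Matrix.neg_mulVec, CharTwo.neg_eq]

theorem add_self_eq_zero {α : Type*} (x : α → ZMod 2) : x + x = 0 :=
  funext fun i ↦ CharTwo.add_self_eq_zero (x i)

theorem form_self (x : l ⊕ l → ZMod 2) : form l x x = 0 := by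
  rw [form_apply]
  exact Finset.sum_eq_zero fun i _ ↦ by rw [mul_comm, CharTwo.add_self_eq_zero]

theorem form_comm (x y : l ⊕ l → ZMod 2) : form l x y = form l y x := by
  simp only [form_apply]
  exact Finset.sum_congr rfl fun i _ ↦ by ring

theorem form_single_inl (i : l) (x : l ⊕ l → ZMod 2) :
    form l (Pi.single (.inl i) 1) x = x (.inr i) := by
  simp [form_apply, Pi.single_apply]

theorem form_single_inr (i : l) (x : l ⊕ l → ZMod 2) :
    form l (Pi.single (.inr i) 1) x = x (.inl i) := by
  simp [form_apply, Pi.single_apply]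

theorem exists_form_eq_one {x : l ⊕ l → ZMod 2} (hx : x ≠ 0) : ∃ y, form l y x = 1 := by
  obtain ⟨i, hi⟩ := Function.ne_iff.mp hx
  have h1 : x i = 1 := Fin.eq_one_of_ne_zero _ hi
  cases i with
  | inl i => exact ⟨_, (form_single_inr i x).trans h1⟩
  | inr i => exact ⟨_, (form_single_inl i x).trans h1⟩

theorem form_mulVec (g : symplecticGroup l (ZMod 2)) (x y : l ⊕ l → ZMod 2) :
    form l (g.1 *ᵥ x) (g.1 *ᵥ y) = form l x y := by
  simp only [form, Matrix.toBilin'_apply']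
  conv_rhs => rw [← SymplecticGroup.mem_iff'.mp g.2]
  simp only [← mulVec_mulVec, dotProduct_mulVec, vecMul_transpose]

theorem ext_mulVec {g k : symplecticGroup l (ZMod 2)} (h : ∀ x, g.1 *ᵥ x = k.1 *ᵥ x) : g = k :=
  Subtype.ext (Matrix.mulVec_injective (funext h))

/-- The matrix of the symplectic transvection `x ↦ x + form l v x • v`. -/
def transvectionMatrix (v : l ⊕ l → ZMod 2) : Matrix (l ⊕ l) (l ⊕ l) (ZMod 2) :=
  1 + vecMulVec v (v ᵥ* J l (ZMod 2))

theorem transvectionMatrix_mulVec (v x : l ⊕ l → ZMod 2) :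
    transvectionMatrix v *ᵥ x = x + form l v x • v := by
  simp [transvectionMatrix, Matrix.add_mulVec, Matrix.vecMulVec_mulVec, form,
    Matrix.toBilin'_apply', dotProduct_mulVec]

theorem transvectionMatrix_mem (v : l ⊕ l → ZMod 2) :
    transvectionMatrix v ∈ symplecticGroup l (ZMod 2) := by
  rw [SymplecticGroup.mem_iff']
  apply Matrix.toBilin'.injective
  refine LinearMap.ext₂ fun x y ↦ ?_
  have key : form l (transvectionMatrix v *ᵥ x) (transvectionMatrix v *ᵥ y) = form l x y := by
    simp only [transvectionMatrix_mulVec, map_add, map_smul, LinearMap.add_apply,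
      LinearMap.smul_apply, form_self, form_comm x v, smul_eq_mul]
    linear_combination form l v x * form l v y * CharTwo.two_eq_zero (R := ZMod 2)
  rw [← key]
  simp only [form, Matrix.toBilin'_apply', ← mulVec_mulVec, dotProduct_mulVec, vecMul_transpose]

/-- The symplectic transvection along `v`. -/
def transvection (v : l ⊕ l → ZMod 2) : symplecticGroup l (ZMod 2) :=
  ⟨transvectionMatrix v, transvectionMatrix_mem v⟩

theorem transvection_mulVec (v x : l ⊕ l → ZMod 2) :
    (transvection v).1 *ᵥ x = x + form l v x • v :=
  transvectionMatrix_mulVec v x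

theorem coe_mul_mulVec (g k : symplecticGroup l (ZMod 2)) (x : l ⊕ l → ZMod 2) :
    (g * k).1 *ᵥ x = g.1 *ᵥ (k.1 *ᵥ x) := by
  simp [Matrix.mulVec_mulVec]

theorem transvection_zero : transvection (0 : l ⊕ l → ZMod 2) = 1 :=
  ext_mulVec fun x ↦ by simp [transvection_mulVec]

theorem conj_transvection (g : symplecticGroup l (ZMod 2)) (v : l ⊕ l → ZMod 2) :
    g * transvection v * g⁻¹ = transvection (g.1 *ᵥ v) := by
  rw [mul_inv_eq_iff_eq_mul]
  refine ext_mulVec fun x ↦ ?_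
  simp only [coe_mul_mulVec, transvection_mulVec, form_mulVec, mulVec_add, mulVec_smul]

theorem transvection_mulVec_mem {H : Subgroup (symplecticGroup l (ZMod 2))}
    {g : symplecticGroup l (ZMod 2)} {v : l ⊕ l → ZMod 2} (hg : g ∈ H)
    (hv : transvection v ∈ H) : transvection (g.1 *ᵥ v) ∈ H := by
  rw [← conj_transvection]
  exact H.mul_mem (H.mul_mem hg hv) (H.inv_mem hg)

theorem transvection_add_mem {H : Subgroup (symplecticGroup l (ZMod 2))}
    {u v : l ⊕ l → ZMod 2} (hu : transvection u ∈ H) (hv : transvection v ∈ H)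
    (huv : form l u v = 1) : transvection (u + v) ∈ H := by
  have := transvection_mulVec_mem hu hv
  rwa [transvection_mulVec, huv, one_smul, add_comm] at this

theorem transvection_mul_mem_iff {H : Subgroup (symplecticGroup l (ZMod 2))}
    {v : l ⊕ l → ZMod 2} (hv : transvection v ∈ H) {g : symplecticGroup l (ZMod 2)} :
    transvection v * g ∈ H ↔ g ∈ H :=
  H.mul_mem_cancel_left hv

/-- The vectors moved by `g`. -/
def moved (g : symplecticGroup l (ZMod 2)) : Finset (l ⊕ l → ZMod 2) :=
  {x | g.1 *ᵥ x ≠ x}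

/-- If `u` is a displacement `g y - y`, then every fixed vector of `g` is orthogonal to `u`. -/
theorem form_add_of_fixed {g : symplecticGroup l (ZMod 2)} {w : l ⊕ l → ZMod 2}
    (hw : g.1 *ᵥ w = w) (y : l ⊕ l → ZMod 2) : form l (y + g.1 *ᵥ y) w = 0 := by
  have := form_mulVec g y w
  rw [hw] at this
  rw [map_add, LinearMap.add_apply, this, CharTwo.add_self_eq_zero]

theorem transvection_mul_fixed {g : symplecticGroup l (ZMod 2)} {w : l ⊕ l → ZMod 2}
    (hw : g.1 *ᵥ w = w) (y : l ⊕ l → ZMod 2) :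
    (transvection (y + g.1 *ᵥ y) * g).1 *ᵥ w = w := by
  rw [coe_mul_mulVec, hw, transvection_mulVec, form_add_of_fixed hw, zero_smul, add_zero]

theorem exists_moved_ssubset_of_form {g : symplecticGroup l (ZMod 2)} {x : l ⊕ l → ZMod 2}
    (hx : form l x (g.1 *ᵥ x) = 1) :
    moved (transvection (x + g.1 *ᵥ x) * g) ⊂ moved g := by
  refine Finset.ssubset_iff_of_subset (fun w hw ↦ ?_) |>.mpr ⟨x, ?_, ?_⟩
  · simp only [moved, Finset.mem_filter_univ] at hw ⊢
    exact fun h ↦ hw (transvection_mul_fixed h x)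
  · simp only [moved, Finset.mem_filter_univ]
    intro h
    rw [h, form_self] at hx
    exact zero_ne_one hx
  · simp only [moved, Finset.mem_filter_univ, not_not]
    rw [coe_mul_mulVec, transvection_mulVec, map_add, LinearMap.add_apply, hx, form_self,
      add_zero, one_smul, add_comm x, ← add_assoc, add_self_eq_zero, zero_add]

/-- The symplectic group over `ZMod 2` is generated by transvections. -/
theorem eq_top_of_transvection_mem {H : Subgroup (symplecticGroup l (ZMod 2))}
    (hH : ∀ v, transvection v ∈ H) : H = ⊤ := by
  refine (Subgroup.eq_top_iff' H).mpr fun g ↦ ?_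
  induction hm : moved g using Finset.strongInduction generalizing g with
  | H s ih =>
    subst hm
    by_cases hyp : ∃ x, form l x (g.1 *ᵥ x) = 1
    · obtain ⟨x, hx⟩ := hyp
      exact (transvection_mul_mem_iff (hH _)).mp
        (ih _ (exists_moved_ssubset_of_form hx) _ rfl)
    · have hyp0 : ∀ x, form l x (g.1 *ᵥ x) = 0 := fun x ↦ by
        by_contra h
        exact hyp ⟨x, Fin.eq_one_of_ne_zero _ h⟩
      by_cases hg : g = 1
      · exact hg ▸ H.one_mem
      obtain ⟨y, hy⟩ : ∃ y, g.1 *ᵥ y ≠ y := by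
        by_contra! h
        exact hg (ext_mulVec fun x ↦ by simp [h x])
      have hu : y + g.1 *ᵥ y ≠ 0 := fun h ↦ hy (by
        rw [← add_zero (g.1 *ᵥ y), ← add_self_eq_zero y, ← add_assoc, add_comm (g.1 *ᵥ y), h,
          zero_add])
      obtain ⟨x, hx⟩ := exists_form_eq_one hu
      set k := transvection (y + g.1 *ᵥ y) * g with hk
      have hxk : form l x (k.1 *ᵥ x) = 1 := by
        have h1 : form l x (g.1 *ᵥ y) + form l y (g.1 *ᵥ x) = 0 := by
          have := hyp0 (x + y)
          simpa [mulVec_add, hyp0] using this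
        have h2 := form_mulVec g y x
        rw [map_add] at hx
        rw [hk, coe_mul_mulVec, transvection_mulVec]
        simp only [map_add, map_smul, LinearMap.add_apply, hyp0, hx, h2, smul_eq_mul]
        rw [form_comm y x]
        linear_combination hx + h1 -
          form l x (g.1 *ᵥ y) * CharTwo.two_eq_zero (R := ZMod 2)
      rw [← transvection_mul_mem_iff (hH (y + g.1 *ᵥ y)),
        ← transvection_mul_mem_iff (hH (x + k.1 *ᵥ x))]
      refine ih _ ((exists_moved_ssubset_of_form hxk).trans_subset fun w hw ↦ ?_) _ rfl
      simp only [moved, Finset.mem_filter_univ] at hw ⊢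
      exact fun h ↦ hw (transvection_mul_fixed h y)

end Transvection

section Points

variable {l ι : Type*} [Fintype l] [DecidableEq l] [DecidableEq ι] {p : ι → l ⊕ l → ZMod 2}

theorem form_points (hp : ∀ i j, i ≠ j → form l (p i) (p j) = 1) (i j : ι) :
    form l (p i) (p j) = 1 + if i = j then 1 else 0 := by
  split_ifs with h
  · rw [h, form_self]
    rfl
  · rw [hp i j h, add_zero]

theorem form_sum_point (hp : ∀ i j, i ≠ j → form l (p i) (p j) = 1) (A : Finset ι) (i : ι) :
    form l (∑ j ∈ A, p j) (p i) = A.card + if i ∈ A then 1 else 0 := by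
  simp [form_points hp, Finset.sum_add_distrib]

theorem transvection_swap_mulVec (hp : ∀ i j, i ≠ j → form l (p i) (p j) = 1) {i j : ι}
    (hij : i ≠ j) (k : ι) :
    (transvection (p i + p j)).1 *ᵥ p k = p (Equiv.swap i j k) := by
  rw [transvection_mulVec, map_add, LinearMap.add_apply]
  rcases eq_or_ne k i with rfl | hki
  · rw [form_self, hp j k hij.symm, Equiv.swap_apply_left, zero_add, one_smul, ← add_assoc,
      add_self_eq_zero, zero_add]
  rcases eq_or_ne k j with rfl | hkj
  · rw [form_self, hp i k hij, Equiv.swap_apply_right, add_zero, one_smul, add_comm (p i),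
      ← add_assoc, add_self_eq_zero, zero_add]
  · rw [hp i k hki.symm, hp j k hkj.symm, Equiv.swap_apply_of_ne_of_ne hki hkj,
      CharTwo.add_self_eq_zero, zero_smul, add_zero]

theorem exists_mulVec_eq_perm [Finite ι] (hp : ∀ i j, i ≠ j → form l (p i) (p j) = 1)
    (σ : Equiv.Perm ι) :
    ∃ g : symplecticGroup l (ZMod 2), ∀ i, g.1 *ᵥ p i = p (σ i) := by
  induction σ using Equiv.Perm.swap_induction_on with
  | one => exact ⟨1, fun i ↦ by simp⟩
  | swap_mul σ x y hxy ih =>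
    obtain ⟨g, hg⟩ := ih
    refine ⟨transvection (p x + p y) * g, fun i ↦ ?_⟩
    rw [coe_mul_mulVec, hg, transvection_swap_mulVec hp hxy, Equiv.Perm.mul_apply]

theorem transvection_sum_mem_of_card_eq {H : Subgroup (symplecticGroup l (ZMod 2))}
    (hp : ∀ i j, i ≠ j → form l (p i) (p j) = 1)
    (hpair : ∀ i j, transvection (p i + p j) ∈ H) {A B : Finset ι} (hAB : A.card = B.card)
    (hA : transvection (∑ i ∈ A, p i) ∈ H) : transvection (∑ i ∈ B, p i) ∈ H := by
  induction hn : (B \ A).card generalizing A with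
  | zero =>
    rwa [Finset.eq_of_subset_of_card_le
      (Finset.sdiff_eq_empty_iff_subset.mp (Finset.card_eq_zero.mp hn)) hAB.le]
  | succ n ih =>
    obtain ⟨j, hj⟩ := Finset.card_pos.mp (hn.symm ▸ Nat.succ_pos n : 0 < (B \ A).card)
    obtain ⟨i, hi⟩ : (A \ B).Nonempty := by
      rw [← Finset.card_pos, Finset.card_sdiff_comm hAB, hn]
      exact Nat.succ_pos n
    rw [Finset.mem_sdiff] at hi hj
    have hj' : j ∉ A.erase i := fun h ↦ hj.2 (Finset.mem_of_mem_erase h)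
    refine ih (A := insert j (A.erase i)) ?_ ?_ ?_
    · rw [Finset.card_insert_of_notMem hj', Finset.card_erase_add_one hi.1, hAB]
    · have hf : form l (∑ k ∈ A, p k) (p i + p j) = 1 := by
        rw [map_add, form_sum_point hp, form_sum_point hp, if_pos hi.1, if_neg hj.2]
        linear_combination (A.card : ZMod 2) * CharTwo.two_eq_zero (R := ZMod 2)
      have := transvection_add_mem hA (hpair i j) hf
      rw [← Finset.add_sum_erase A p hi.1] at this
      rw [Finset.sum_insert hj']
      convert this using 2
      linear_combination (exp := 1) -(add_self_eq_zero (p i))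
    · have : B \ insert j (A.erase i) = (B \ A).erase j := by
        rw [Finset.sdiff_insert, ← Finset.insert_erase hi.1, Finset.erase_insert_eq_erase,
          Finset.erase_idem, Finset.sdiff_insert, Finset.erase_eq_of_notMem
            (fun h ↦ hi.2 (Finset.mem_sdiff.mp h).1)]
      rw [this, Finset.card_erase_of_mem (Finset.mem_sdiff.mpr hj), hn, Nat.add_sub_cancel]

theorem transvection_sum_mem_of_even [Fintype ι] {H : Subgroup (symplecticGroup l (ZMod 2))}
    (hp : ∀ i j, i ≠ j → form l (p i) (p j) = 1) (hcard : Odd (Fintype.card ι))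
    (hpair : ∀ i j, transvection (p i + p j) ∈ H)
    (hfour : ∃ F : Finset ι, F.card = 4 ∧ transvection (∑ i ∈ F, p i) ∈ H)
    (k : ℕ) (B : Finset ι) (hB : B.card = 2 * k) : transvection (∑ i ∈ B, p i) ∈ H := by
  induction k generalizing B with
  | zero =>
    rw [Finset.card_eq_zero.mp hB, Finset.sum_empty, transvection_zero]
    exact H.one_mem
  | succ k ih =>
    rcases Nat.eq_zero_or_pos k with rfl | hk
    · obtain ⟨i, j, hij, rfl⟩ := Finset.card_eq_two.mp hB
      rw [Finset.sum_pair hij]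
      exact hpair i j
    obtain ⟨C, hCB, hC⟩ := Finset.exists_subset_card_eq (s := B) (n := 3) (by omega)
    obtain ⟨a, ha⟩ : ∃ a, a ∉ B := by
      by_contra! h
      rw [Finset.eq_univ_of_forall h, Finset.card_univ] at hB
      obtain ⟨m, hm⟩ := hcard
      omega
    have haC : a ∉ C := fun h ↦ ha (hCB h)
    have haD : a ∉ B \ C := fun h ↦ ha (Finset.mem_sdiff.mp h).1
    have hD : (B \ C).card = 2 * k - 1 := by
      rw [Finset.card_sdiff_of_subset hCB]
      omega
    obtain ⟨F, hF, hFH⟩ := hfour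
    have hCH : transvection (∑ i ∈ insert a C, p i) ∈ H :=
      transvection_sum_mem_of_card_eq hp hpair
        (by rw [hF, Finset.card_insert_of_notMem haC, hC]) hFH
    have hDcard : (insert a (B \ C)).card = 2 * k := by
      rw [Finset.card_insert_of_notMem haD, hD]
      omega
    have hDH := ih (insert a (B \ C)) hDcard
    have hf : form l (∑ i ∈ insert a (B \ C), p i) (∑ i ∈ insert a C, p i) = 1 := by
      rw [Finset.sum_insert haC, map_add, map_sum (form l (∑ i ∈ insert a (B \ C), p i)),
        form_sum_point hp,
        if_pos (Finset.mem_insert_self _ _), hDcard]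
      rw [Finset.sum_congr rfl fun i hi ↦ by
        rw [form_sum_point hp, if_neg (by grind), hDcard]]
      simp [CharTwo.two_eq_zero]
    have := transvection_add_mem hDH hCH hf
    rw [Finset.sum_insert haC, Finset.sum_insert haD] at this
    rw [← Finset.sum_sdiff hCB]
    convert this using 2
    linear_combination (exp := 1) -(add_self_eq_zero (p a))

theorem sum_points_eq_zero [Fintype ι] (hp : ∀ i j, i ≠ j → form l (p i) (p j) = 1)
    (hcard : Odd (Fintype.card ι)) (hspan : Submodule.span (ZMod 2) (Set.range p) = ⊤) :
    ∑ i, p i = 0 := by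
  by_contra h
  obtain ⟨y, hy⟩ := exists_form_eq_one h
  have : form l (∑ i, p i) = 0 := by
    refine LinearMap.ext_on_range hspan fun i ↦ ?_
    rw [form_sum_point hp, if_pos (Finset.mem_univ i), Finset.card_univ,
      (ZMod.natCast_eq_one_iff_odd).mpr hcard]
    rfl
  rw [form_comm, this] at hy
  exact zero_ne_one hy

theorem eq_top_of_points [Fintype ι] {H : Subgroup (symplecticGroup l (ZMod 2))}
    (hp : ∀ i j, i ≠ j → form l (p i) (p j) = 1) (hcard : Odd (Fintype.card ι))
    (hspan : Submodule.span (ZMod 2) (Set.range p) = ⊤)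
    (hpair : ∀ i j, transvection (p i + p j) ∈ H)
    (hfour : ∃ F : Finset ι, F.card = 4 ∧ transvection (∑ i ∈ F, p i) ∈ H) : H = ⊤ := by
  refine eq_top_of_transvection_mem fun v ↦ ?_
  obtain ⟨c, rfl⟩ := Submodule.mem_span_range_iff_exists_fun (ZMod 2) |>.mp
    (hspan ▸ Submodule.mem_top : v ∈ Submodule.span (ZMod 2) (Set.range p))
  have hc : ∑ i, c i • p i = ∑ i with c i = 1, p i := by
    rw [Finset.sum_filter]
    refine Finset.sum_congr rfl fun i _ ↦ ?_
    split_ifs with h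
    · rw [h, one_smul]
    · rw [show c i = 0 by by_contra h0; exact h (Fin.eq_one_of_ne_zero _ h0), zero_smul]
  rw [hc]
  generalize ({i | c i = 1} : Finset ι) = A
  rcases Nat.even_or_odd A.card with hA | hA
  · obtain ⟨k, hk⟩ := hA
    exact transvection_sum_mem_of_even hp hcard hpair hfour k A (by omega)
  · have hsum : ∑ i ∈ A, p i = ∑ i ∈ Aᶜ, p i := by
      have h := Finset.sum_add_sum_compl A p
      rw [sum_points_eq_zero hp hcard hspan] at h
      linear_combination (exp := 1) h - add_self_eq_zero (∑ i ∈ Aᶜ, p i)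
    obtain ⟨k, hk⟩ : Even Aᶜ.card := by
      rw [Finset.card_compl]
      exact Nat.Odd.sub_odd hcard hA
    rw [hsum]
    exact transvection_sum_mem_of_even hp hcard hpair hfour k Aᶜ (by omega)

end Points

section Cyclic

variable {l : Type*} [Fintype l] [DecidableEq l] {n : ℕ} {p : ZMod n → l ⊕ l → ZMod 2}

/-- The sum of four cyclically consecutive points. -/
def window (p : ZMod n → l ⊕ l → ZMod 2) (i : ZMod n) : l ⊕ l → ZMod 2 :=
  p i + p (i + 1) + p (i + 2) + p (i + 3)

theorem transvection_window_mem {H : Subgroup (symplecticGroup l (ZMod 2))} [NeZero n]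
    {S : symplecticGroup l (ZMod 2)} (hS : ∀ i, S.1 *ᵥ p i = p (i + 1)) (hSH : S ∈ H)
    (hT : transvection (window p 0) ∈ H) (i : ZMod n) : transvection (window p i) ∈ H := by
  obtain ⟨m, rfl⟩ := ZMod.natCast_zmod_surjective i
  induction m with
  | zero => simpa using hT
  | succ m ih =>
    have := transvection_mulVec_mem hSH ih
    simp only [window, mulVec_add, hS] at this
    convert this using 2
    simp only [window, Nat.cast_succ]
    ring_nf

theorem transvection_add_four_mem {H : Subgroup (symplecticGroup l (ZMod 2))}
    (hp : ∀ i j, i ≠ j → form l (p i) (p j) = 1)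
    (h1 : (1 : ZMod n) ≠ 0) (h2 : (2 : ZMod n) ≠ 0) (h3 : (3 : ZMod n) ≠ 0)
    (h4 : (4 : ZMod n) ≠ 0)
    (hw : ∀ i, transvection (window p i) ∈ H) (i : ZMod n) :
    transvection (p i + p (i + 4)) ∈ H := by
  have e2 : i + 1 + 1 = i + 2 := by ring
  have e3 : i + 1 + 2 = i + 3 := by ring
  have e4 : i + 1 + 3 = i + 4 := by ring
  have hf : form l (window p i) (window p (i + 1)) = 1 := by
    have key {a b : ZMod n} (c : ZMod n) (hc : c ≠ 0) (hab : b = a + c) :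
        form l (p a) (p b) = 1 := hp _ _ fun h ↦ hc (by linear_combination -hab - h)
    simp only [window, e2, e3, e4, map_add, LinearMap.add_apply, form_self,
      form_comm (p (i + 2)) (p (i + 1)), form_comm (p (i + 3)) (p (i + 1)),
      form_comm (p (i + 3)) (p (i + 2)), key (a := i) 1 h1 rfl, key (a := i) 2 h2 rfl,
      key (a := i) 3 h3 rfl, key (a := i) 4 h4 rfl, key (a := i + 1) 1 h1 e2.symm,
      key (a := i + 1) 2 h2 e3.symm, key (a := i + 1) 3 h3 e4.symm,
      key (a := i + 2) (b := i + 3) 1 h1 (by ring), key (a := i + 2) (b := i + 4) 2 h2 (by ring),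
      key (a := i + 3) (b := i + 4) 1 h1 (by ring)]
    rfl
  have := transvection_add_mem (hw i) (hw (i + 1)) hf
  convert this using 2
  simp only [window, e2, e3, e4]
  linear_combination (exp := 1) -(add_self_eq_zero (p (i + 1))) - add_self_eq_zero (p (i + 2)) -
    add_self_eq_zero (p (i + 3))

theorem transvection_add_trans {H : Subgroup (symplecticGroup l (ZMod 2))}
    (hp : ∀ i j, i ≠ j → form l (p i) (p j) = 1) {i j k : ZMod n}
    (hij : transvection (p i + p j) ∈ H) (hjk : transvection (p j + p k) ∈ H) :
    transvection (p i + p k) ∈ H := by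
  rcases eq_or_ne i j with rfl | h1
  · exact hjk
  rcases eq_or_ne j k with rfl | h2
  · exact hij
  rcases eq_or_ne i k with rfl | h3
  · rw [add_self_eq_zero, transvection_zero]
    exact H.one_mem
  have hf : form l (p i + p j) (p j + p k) = 1 := by
    simp only [map_add, LinearMap.add_apply, hp _ _ h1, hp _ _ h2, hp _ _ h3, form_self]
    rfl
  convert transvection_add_mem hij hjk hf using 2
  linear_combination (exp := 1) -(add_self_eq_zero (p j))

theorem transvection_pair_mem {H : Subgroup (symplecticGroup l (ZMod 2))} [NeZero n]
    (hp : ∀ i j, i ≠ j → form l (p i) (p j) = 1) (hn : IsUnit (4 : ZMod n))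
    (h4 : ∀ i, transvection (p i + p (i + 4)) ∈ H) (i j : ZMod n) :
    transvection (p i + p j) ∈ H := by
  have key (m : ℕ) : transvection (p i + p (i + 4 * m)) ∈ H := by
    induction m with
    | zero =>
      rw [Nat.cast_zero, mul_zero, add_zero, add_self_eq_zero, transvection_zero]
      exact H.one_mem
    | succ m ih =>
      convert transvection_add_trans hp ih (h4 _) using 4
      push_cast
      ring
  obtain ⟨u, hu⟩ := hn.exists_right_inv
  obtain ⟨m, hm⟩ := ZMod.natCast_zmod_surjective (u * (j - i))
  have := key m
  rwa [hm, ← mul_assoc, hu, one_mul, add_sub_cancel] at this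

theorem closure_eq_top_of_cyclic {S : symplecticGroup l (ZMod 2)} (hn : Odd n) (hn5 : 5 ≤ n)
    (hp : ∀ i j, i ≠ j → form l (p i) (p j) = 1)
    (hspan : Submodule.span (ZMod 2) (Set.range p) = ⊤)
    (hS : ∀ i, S.1 *ᵥ p i = p (i + 1)) :
    Subgroup.closure {S, transvection (window p 0)} = ⊤ := by
  have : NeZero n := ⟨by omega⟩
  set H := Subgroup.closure {S, transvection (window p 0)}
  have hne (m : ℕ) (h0 : m ≠ 0) (hm : m < n) : (m : ZMod n) ≠ 0 := fun h ↦
    Nat.not_dvd_of_pos_of_lt (Nat.pos_of_ne_zero h0) hm ((ZMod.natCast_eq_zero_iff m n).mp h)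
  have h1 : (1 : ZMod n) ≠ 0 := mod_cast hne 1 (by omega) (by omega)
  have h2 : (2 : ZMod n) ≠ 0 := mod_cast hne 2 (by omega) (by omega)
  have h3 : (3 : ZMod n) ≠ 0 := mod_cast hne 3 (by omega) (by omega)
  have h4 : (4 : ZMod n) ≠ 0 := mod_cast hne 4 (by omega) (by omega)
  have hT : transvection (window p 0) ∈ H := Subgroup.subset_closure (by simp)
  have hunit : IsUnit (4 : ZMod n) := by
    have h := (ZMod.isUnit_iff_coprime 4 n).mpr
      (Nat.Coprime.pow_left 2 (Nat.coprime_two_left.mpr hn))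
    exact_mod_cast h
  have h12 : (1 : ZMod n) ≠ 2 := fun h ↦ h1 (by linear_combination -h)
  have h13 : (1 : ZMod n) ≠ 3 := fun h ↦ h2 (by linear_combination -h)
  have h23 : (2 : ZMod n) ≠ 3 := fun h ↦ h1 (by linear_combination -h)
  have h0mem : (0 : ZMod n) ∉ ({1, 2, 3} : Finset (ZMod n)) := by
    simp [h1.symm, h2.symm, h3.symm]
  have h1mem : (1 : ZMod n) ∉ ({2, 3} : Finset (ZMod n)) := by simp [h12, h13]
  refine eq_top_of_points hp (by rwa [ZMod.card]) hspan
    (transvection_pair_mem hp hunit (transvection_add_four_mem hp h1 h2 h3 h4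
      (transvection_window_mem hS (Subgroup.subset_closure (by simp)) hT)))
    ⟨{0, 1, 2, 3}, ?_, ?_⟩
  · rw [Finset.card_insert_of_notMem h0mem, Finset.card_insert_of_notMem h1mem,
      Finset.card_pair h23]
  · rw [Finset.sum_insert h0mem, Finset.sum_insert h1mem, Finset.sum_pair h23]
    convert hT using 2
    simp only [window, zero_add, add_assoc]

end Cyclic

section Existence

variable {l : Type*} [Fintype l] [LinearOrder l]

/-- The sum of the hyperbolic pairs with index below `i`. -/
def lowerSum (i : l) : l ⊕ l → ZMod 2 :=
  Sum.elim (fun j ↦ if j < i then 1 else 0) (fun j ↦ if j < i then 1 else 0)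

theorem lowerSum_inl {m : Type*} [LinearOrder m] (i j : m) :
    lowerSum i (.inl j) = if j < i then 1 else 0 := rfl

theorem lowerSum_inr {m : Type*} [LinearOrder m] (i j : m) :
    lowerSum i (.inr j) = if j < i then 1 else 0 := rfl

/-- Vectors with pairwise products `1`, one more than the dimension. -/
def point : Option (l ⊕ l) → l ⊕ l → ZMod 2
  | none => 1
  | some (.inl i) => Pi.single (.inl i) 1 + lowerSum i
  | some (.inr i) => Pi.single (.inr i) 1 + lowerSum i

theorem form_of_balanced {x y : l ⊕ l → ZMod 2} (hx : ∀ i, x (.inl i) = x (.inr i))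
    (hy : ∀ i, y (.inl i) = y (.inr i)) : form l x y = 0 := by
  rw [form_apply]
  exact Finset.sum_eq_zero fun i _ ↦ by rw [hx, hy, CharTwo.add_self_eq_zero]

theorem form_point {i j : Option (l ⊕ l)} (hij : i ≠ j) : form l (point i) (point j) = 1 := by
  have hqq (i j : l) : form l (lowerSum i) (lowerSum j) = 0 :=
    form_of_balanced (fun _ ↦ rfl) (fun _ ↦ rfl)
  have h1q (j : l) : form l 1 (lowerSum j) = 0 :=
    form_of_balanced (fun _ ↦ rfl) (fun _ ↦ rfl)
  have hq1 (j : l) : form l (lowerSum j) 1 = 0 :=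
    form_of_balanced (fun _ ↦ rfl) (fun _ ↦ rfl)
  have hqe (i j : l) : form l (lowerSum i) (Pi.single (.inl j) 1) = if j < i then 1 else 0 := by
    rw [form_comm, form_single_inl]; rfl
  have hqf (i j : l) : form l (lowerSum i) (Pi.single (.inr j) 1) = if j < i then 1 else 0 := by
    rw [form_comm, form_single_inr]; rfl
  have h1e (j : l) : form l 1 (Pi.single (.inl j) 1) = 1 := by
    rw [form_comm, form_single_inl]; rfl
  have h1f (j : l) : form l 1 (Pi.single (.inr j) 1) = 1 := by
    rw [form_comm, form_single_inr]; rfl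
  rcases i with _ | i | i <;> rcases j with _ | j | j <;>
    simp only [point, map_add, LinearMap.add_apply, hqq, h1q, hq1, hqe, hqf, h1e, h1f,
      form_single_inl, form_single_inr, Pi.single_apply, lowerSum_inl, lowerSum_inr,
      Pi.one_apply, ne_eq, reduceCtorEq, not_true_eq_false, not_false_eq_true, Option.some.injEq,
      Sum.inl.injEq, Sum.inr.injEq] at hij ⊢
  all_goals try rfl
  all_goals rcases lt_trichotomy i j with h | rfl | h <;> simp_all [not_lt_of_gt, ne_of_gt, ne_of_lt]

theorem span_point :
    Submodule.span (ZMod 2) (Set.range (point (l := l))) = ⊤ := by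
  set W := Submodule.span (ZMod 2) (Set.range (point (l := l)))
  have hW (i) : point (l := l) i ∈ W := Submodule.subset_span ⟨i, rfl⟩
  have hq (i : l) : lowerSum i ∈ W := by
    have : lowerSum i =
        ∑ j with j < i, (point (some (.inl j)) + point (some (.inr j)) : l ⊕ l → ZMod 2) := by
      have e (j : l) : (point (some (.inl j)) + point (some (.inr j)) : l ⊕ l → ZMod 2) =
          Pi.single (.inl j) 1 + Pi.single (.inr j) 1 := by
        simp only [point]
        linear_combination (exp := 1) add_self_eq_zero (lowerSum j)
      simp only [e]
      ext (k | k) <;> simp [lowerSum, Pi.single_apply, Finset.sum_apply]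
    rw [this]
    exact W.sum_mem fun j _ ↦ W.add_mem (hW _) (hW _)
  have hs (k : l ⊕ l) : Pi.single k 1 ∈ W := by
    cases k with
    | inl i => exact (W.add_mem_iff_left (hq i)).mp (hW (some (.inl i)))
    | inr i => exact (W.add_mem_iff_left (hq i)).mp (hW (some (.inr i)))
  refine eq_top_iff.mpr ?_
  rw [← (Pi.basisFun (ZMod 2) (l ⊕ l)).span_eq, Submodule.span_le]
  rintro _ ⟨k, rfl⟩
  rw [Pi.basisFun_apply]
  exact hs k

end Existence

end Symplectic

/-- For every natural number `h ≥ 9`, the symplectic group `Sp(2h; ℤ/2ℤ)`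
is generated by two elements. -/
theorem sp_two_generators (h : ℕ) (hh : 9 ≤ h) :
    ∃ S T : Matrix.symplecticGroup (Fin h) (ZMod 2),
      Subgroup.closure ({S, T} : Set (Matrix.symplecticGroup (Fin h) (ZMod 2))) = ⊤ := by
  obtain ⟨e⟩ : Nonempty (ZMod (2 * h + 1) ≃ Option (Fin h ⊕ Fin h)) :=
    Fintype.card_eq.mp (by simp [ZMod.card]; ring)
  have hp (i j) (hij : i ≠ j) :
      Symplectic.form (Fin h) (Symplectic.point (e i)) (Symplectic.point (e j)) = 1 :=
    Symplectic.form_point (e.injective.ne hij)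
  obtain ⟨S, hS⟩ := Symplectic.exists_mulVec_eq_perm
    (p := fun i ↦ Symplectic.point (e i)) hp (Equiv.addRight 1)
  exact ⟨S, _, Symplectic.closure_eq_top_of_cyclic ⟨h, rfl⟩ (by omega) hp
    (by rw [← Symplectic.span_point, ← e.surjective.range_comp Symplectic.point]; rfl) hS⟩
end

section
/- For every natural number h with h ≥ 9, the symplectic group Sp(2h; Z/2Z) is generated by two elements one of which has order dividing 2h+1; that is, there exist matrices S, T in Sp(2h; Z/2Z) with T^(2h+1) = 1 such that the subgroup of Sp(2h; Z/2Z) generated by {S, T} is the whole group. -/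
namespace SymplecticGroup

open Matrix

section Transvections

variable {l : Type*} [DecidableEq l] [Fintype l]

/-- The standard symplectic form over the field with two elements. -/
def form : LinearMap.BilinForm (ZMod 2) (l ⊕ l → ZMod 2) :=
  Matrix.toBilin' (J l (ZMod 2))

theorem form_apply (x y : l ⊕ l → ZMod 2) :
    form x y = ∑ i, (x (Sum.inl i) * y (Sum.inr i) + x (Sum.inr i) * y (Sum.inl i)) := by
  rw [form, Matrix.toBilin'_apply']
  simp only [J, dotProduct, fromBlocks_mulVec, Fintype.sum_sum_type, Finset.sum_add_distrib]
  simp [Function.comp_def, ZMod.neg_eq_self_mod_two, neg_mulVec]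

theorem form_self (x : l ⊕ l → ZMod 2) : form x x = 0 := by
  rw [form_apply]
  exact Finset.sum_eq_zero fun i _ => by rw [mul_comm, CharTwo.add_self_eq_zero]

theorem form_comm (x y : l ⊕ l → ZMod 2) : form x y = form y x := by
  simp only [form_apply]
  exact Finset.sum_congr rfl fun i _ => by ring

theorem eq_zero_of_form_eq_zero {x : l ⊕ l → ZMod 2} (hx : ∀ y, form x y = 0) : x = 0 := by
  ext (i | i)
  · simpa [form_apply, Pi.single_apply] using hx (Pi.single (Sum.inr i) 1)
  · simpa [form_apply, Pi.single_apply] using hx (Pi.single (Sum.inl i) 1)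

theorem mem_iff_form {A : Matrix (l ⊕ l) (l ⊕ l) (ZMod 2)} :
    A ∈ symplecticGroup l (ZMod 2) ↔ ∀ x y, form (A *ᵥ x) (A *ᵥ y) = form x y := by
  rw [mem_iff', ← (Matrix.toBilin' (R₁ := ZMod 2) (n := l ⊕ l)).injective.eq_iff,
    ← Matrix.toBilin'_comp, LinearMap.ext_iff₂]
  rfl

theorem form_mulVec (g : symplecticGroup l (ZMod 2)) (x y : l ⊕ l → ZMod 2) :
    form (g.1 *ᵥ x) (g.1 *ᵥ y) = form x y :=
  mem_iff_form.1 g.2 x y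

theorem ext_mulVec {g k : symplecticGroup l (ZMod 2)} (hgk : ∀ x, g.1 *ᵥ x = k.1 *ᵥ x) :
    g = k :=
  Subtype.ext (Matrix.ext_of_mulVec_single fun _ => hgk _)

theorem mul_mulVec (g k : symplecticGroup l (ZMod 2)) (x : l ⊕ l → ZMod 2) :
    (g * k).1 *ᵥ x = g.1 *ᵥ (k.1 *ᵥ x) := by
  simp

private theorem transvection_aux (v x : l ⊕ l → ZMod 2) :
    (1 + vecMulVec v (J l (ZMod 2) *ᵥ v)) *ᵥ x = x + form x v • v := by
  rw [add_mulVec, one_mulVec, vecMulVec_mulVec, form, Matrix.toBilin'_apply', dotProduct_comm]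
  simp

/-- The symplectic transvection `x ↦ x + ⟨x, v⟩ v`. -/
def transvection (v : l ⊕ l → ZMod 2) : symplecticGroup l (ZMod 2) :=
  ⟨1 + vecMulVec v (J l (ZMod 2) *ᵥ v), mem_iff_form.2 fun x y => by
    simp only [transvection_aux, map_add, map_smul, LinearMap.add_apply, LinearMap.smul_apply,
      smul_eq_mul, form_self, form_comm v y]
    linear_combination CharTwo.add_self_eq_zero (form x v * form y v)⟩

theorem transvection_mulVec (v x : l ⊕ l → ZMod 2) :
    (transvection v).1 *ᵥ x = x + form x v • v :=
  transvection_aux v x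

theorem transvection_zero : transvection (0 : l ⊕ l → ZMod 2) = 1 :=
  ext_mulVec fun x => by simp [transvection_mulVec]

theorem mul_transvection (g : symplecticGroup l (ZMod 2)) (v : l ⊕ l → ZMod 2) :
    g * transvection v = transvection (g.1 *ᵥ v) * g :=
  ext_mulVec fun x => by
    simp only [mul_mulVec, transvection_mulVec, mulVec_add, mulVec_smul, form_mulVec]

theorem transvection_mul_self (v : l ⊕ l → ZMod 2) : transvection v * transvection v = 1 :=
  ext_mulVec fun x => by
    rw [mul_mulVec, transvection_mulVec, transvection_mulVec, map_add, map_smul,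
      LinearMap.add_apply, LinearMap.smul_apply, form_self, smul_zero, add_zero, add_assoc,
      ZModModule.add_self, add_zero, Submonoid.coe_one, one_mulVec]

theorem transvection_commute {u v : l ⊕ l → ZMod 2} (huv : form u v = 0) :
    Commute (transvection u) (transvection v) := by
  have := mul_transvection (transvection u) v
  rwa [transvection_mulVec, form_comm, huv, zero_smul, add_zero] at this

theorem transvection_braid {u v : l ⊕ l → ZMod 2} (huv : form u v = 1) :
    transvection u * transvection v * transvection u =
      transvection v * transvection u * transvection v := by
  rw [mul_transvection (transvection u) v, mul_transvection (transvection v) u,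
    transvection_mulVec, transvection_mulVec, huv, form_comm v u, huv, one_smul, one_smul,
    add_comm v u, mul_assoc, mul_assoc, transvection_mul_self, transvection_mul_self]

theorem transvection_mul_pow_three {u v : l ⊕ l → ZMod 2} (huv : form u v = 1) :
    (transvection u * transvection v) ^ 3 = 1 := by
  have hb := transvection_braid huv
  calc (transvection u * transvection v) ^ 3
      = (transvection u * transvection v * transvection u) *
          (transvection v * transvection u * transvection v) := by
        simp only [pow_succ, pow_zero, one_mul, mul_assoc]
    _ = transvection v * (transvection u * (transvection v * transvection v) * transvection u) *
          transvection v := by rw [hb]; simp only [mul_assoc]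
    _ = 1 := by simp only [transvection_mul_self, mul_one]

variable {H : Subgroup (symplecticGroup l (ZMod 2))}

theorem transvection_mulVec_mem {g : symplecticGroup l (ZMod 2)} (hg : g ∈ H)
    {v : l ⊕ l → ZMod 2} (hv : transvection v ∈ H) : transvection (g.1 *ᵥ v) ∈ H := by
  rw [← mul_inv_eq_iff_eq_mul.2 (mul_transvection g v)]
  exact H.mul_mem (H.mul_mem hg hv) (H.inv_mem hg)

theorem transvection_add_mem {u v : l ⊕ l → ZMod 2} (hu : transvection u ∈ H)
    (hv : transvection v ∈ H) (huv : form u v = 1) : transvection (u + v) ∈ H := by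
  have := transvection_mulVec_mem hv hu
  rwa [transvection_mulVec, huv, one_smul] at this

/-- If `⟨g x, x⟩ = 1`, then composing `g` with a transvection fixes `x` and keeps the fixed points
of `g`. -/
theorem exists_transvection_mul_fixes (g : symplecticGroup l (ZMod 2)) {w : l ⊕ l → ZMod 2}
    (hw : form (g.1 *ᵥ w) w = 1) :
    ∃ u, (transvection u * g).1 *ᵥ w = w ∧
      ∀ x, g.1 *ᵥ x = x → (transvection u * g).1 *ᵥ x = x := by
  refine ⟨g.1 *ᵥ w + w, ?_, fun x hx => ?_⟩
  · rw [mul_mulVec, transvection_mulVec, map_add, form_self, hw, zero_add, one_smul, ← add_assoc,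
      ZModModule.add_self, zero_add]
  · have : form (g.1 *ᵥ x) (g.1 *ᵥ w + w) = 0 := by
      rw [map_add, form_mulVec, hx, CharTwo.add_self_eq_zero]
    rw [mul_mulVec, transvection_mulVec, this, zero_smul, add_zero, hx]

theorem eq_top_of_transvection_mem (hH : ∀ v, transvection v ∈ H) : H = ⊤ := by
  rw [eq_top_iff]
  intro g _
  induction hn : (Finset.univ.filter fun x => g.1 *ᵥ x ≠ x).card using Nat.strong_induction_on
    generalizing g with
  | _ n ih =>
  have key : ∀ k : symplecticGroup l (ZMod 2), k ∈ H → ∀ w, (k * g).1 *ᵥ w = w → g.1 *ᵥ w ≠ w →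
      (∀ x, g.1 *ᵥ x = x → (k * g).1 *ᵥ x = x) → g ∈ H := by
    intro k hk w hw hgw hfix
    refine (H.mul_mem_cancel_left hk).1 (ih _ ?_ (Subgroup.mem_top _) rfl)
    rw [← hn]
    refine Finset.card_lt_card (Finset.ssubset_iff_of_subset ?_ |>.2 ⟨w, ?_, ?_⟩)
    · intro x
      simp only [Finset.mem_filter_univ]
      exact fun hx hx' => hx (hfix x hx')
    · simpa only [Finset.mem_filter_univ] using hgw
    · simpa only [Finset.mem_filter_univ, not_not] using hw
  have ne_of_form : ∀ w, form (g.1 *ᵥ w) w = 1 → g.1 *ᵥ w ≠ w := fun w hw h => by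
    rw [h, form_self] at hw
    exact zero_ne_one hw
  have bit : ∀ a : ZMod 2, a ≠ 0 → a = 1 := by decide
  by_cases hone : ∃ w, form (g.1 *ᵥ w) w = 1
  · obtain ⟨w, hw⟩ := hone
    obtain ⟨u, hu, hfix⟩ := exists_transvection_mul_fixes g hw
    exact key _ (hH u) w hu (ne_of_form w hw) hfix
  have hzero : ∀ w, form (g.1 *ᵥ w) w = 0 := fun w => by
    by_contra h
    exact hone ⟨w, bit _ h⟩
  by_cases hid : ∃ v, g.1 *ᵥ v ≠ v
  swap
  · push Not at hid
    have : g = 1 := ext_mulVec fun x => by simpa using hid x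
    exact this ▸ H.one_mem
  obtain ⟨v, hv⟩ := hid
  set u := g.1 *ᵥ v + v with hu
  have hpol : ∀ x y, form (g.1 *ᵥ x) y = form (g.1 *ᵥ y) x := fun x y => by
    have := hzero (x + y)
    simp only [mulVec_add, map_add, LinearMap.add_apply, hzero, zero_add, add_zero] at this
    exact (CharTwo.add_eq_zero.1 this).symm
  have hgu : ∀ x, form (g.1 *ᵥ x) u = form x u := fun x => by
    rw [hu, map_add, map_add, form_mulVec, hpol x v, form_comm (g.1 *ᵥ v) x, add_comm]
  have hu0 : u ≠ 0 := fun h => hv (by rwa [hu, ← ZModModule.sub_eq_add, sub_eq_zero] at h)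
  obtain ⟨w, hw⟩ : ∃ w, form u w ≠ 0 := by
    by_contra! h
    exact hu0 (eq_zero_of_form_eq_zero h)
  replace hw : form w u = 1 := by rw [form_comm]; exact bit _ hw
  have hfix : ∀ x, g.1 *ᵥ x = x → form x u = 0 := fun x hx => by
    rw [hu, map_add]
    nth_rw 1 [← hx]
    rw [form_mulVec, CharTwo.add_self_eq_zero]
  have hw' : form ((transvection u * g).1 *ᵥ w) w = 1 := by
    rw [mul_mulVec, transvection_mulVec, hgu, hw, one_smul, map_add, LinearMap.add_apply, hzero,
      form_comm, hw, zero_add]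
  obtain ⟨u', hu', hfix'⟩ := exists_transvection_mul_fixes _ hw'
  simp only [← mul_assoc] at hu' hfix'
  refine key _ (H.mul_mem (hH u') (hH u)) w hu' (fun h => ?_) fun x hx => hfix' x ?_
  · rw [hfix w h] at hw
    exact zero_ne_one hw
  · rw [mul_mulVec, transvection_mulVec, hx, hfix x hx, zero_smul, add_zero]

end Transvections

section Frames

variable {l : Type*} [DecidableEq l] [Fintype l] {ι : Type*} [DecidableEq ι]

/-- A family of vectors pairing to `1` whenever they are distinct, with zero orthogonal. -/
structure IsFrame (p : ι → l ⊕ l → ZMod 2) : Prop where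
  form_eq : ∀ i j, form (p i) (p j) = if i = j then 0 else 1
  eq_zero : ∀ x, (∀ i, form x (p i) = 0) → x = 0

namespace IsFrame

variable {p : ι → l ⊕ l → ZMod 2}

theorem form_sum (hp : IsFrame p) {s : Finset ι} (hs : Even s.card) (j : ι) :
    form (∑ i ∈ s, p i) (p j) = if j ∈ s then 1 else 0 := by
  have hflip : ∀ i, (if i = j then 0 else 1 : ZMod 2) = 1 + if i = j then 1 else 0 := fun i => by
    split_ifs <;> decide
  simp only [map_sum, LinearMap.sum_apply, hp.form_eq, hflip, Finset.sum_add_distrib,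
    Finset.sum_ite_eq', Finset.sum_const, nsmul_eq_mul, mul_one]
  rw [CharTwo.natCast_eq_ite, if_pos hs, zero_add]

theorem form_sum_sum (hp : IsFrame p) {s : Finset ι} (hs : Even s.card) (t : Finset ι) :
    form (∑ i ∈ s, p i) (∑ j ∈ t, p j) = ((s ∩ t).card : ZMod 2) := by
  rw [map_sum, Finset.sum_congr rfl fun j _ => hp.form_sum hs j, Finset.sum_boole,
    Finset.filter_mem_eq_inter, Finset.inter_comm]

theorem sum_univ [Fintype ι] (hp : IsFrame p) (hodd : Odd (Fintype.card ι)) : ∑ i, p i = 0 := by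
  refine hp.eq_zero _ fun j => ?_
  rw [← Finset.add_sum_erase _ _ (Finset.mem_univ j), map_add, LinearMap.add_apply, form_self,
    zero_add, hp.form_sum, if_neg (Finset.notMem_erase _ _)]
  rw [Finset.card_erase_of_mem (Finset.mem_univ j), Finset.card_univ]
  exact hodd.tsub_odd odd_one

theorem exists_eq_sum [Fintype ι] (hp : IsFrame p) (hodd : Odd (Fintype.card ι))
    (v : l ⊕ l → ZMod 2) :
    ∃ s : Finset ι, Even s.card ∧ v = ∑ i ∈ s, p i := by
  have bit : ∀ a : ZMod 2, (if a = 1 then 1 else 0) = a := by decide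
  set s : Finset ι := Finset.univ.filter fun j => form v (p j) = 1 with hs
  have hcard : Even s.card := by
    rw [← ZMod.natCast_eq_zero_iff_even, hs, ← Finset.sum_boole]
    simp only [bit]
    rw [← map_sum, hp.sum_univ hodd, map_zero]
  refine ⟨s, hcard, ?_⟩
  rw [← sub_eq_zero]
  refine hp.eq_zero _ fun j => ?_
  rw [map_sub, LinearMap.sub_apply, hp.form_sum hcard, hs]
  simp only [Finset.mem_filter_univ, bit, sub_self]

theorem ext (hp : IsFrame p) {g k : symplecticGroup l (ZMod 2)}
    (hgk : ∀ i, g.1 *ᵥ p i = k.1 *ᵥ p i) : g = k := by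
  refine ext_mulVec fun x => ?_
  rw [← sub_eq_zero]
  have : k⁻¹ * g = 1 → g.1 *ᵥ x - k.1 *ᵥ x = 0 := fun h => by
    rw [inv_mul_eq_one.1 h, sub_self]
  refine this (ext_mulVec fun y => ?_)
  have hfix : ∀ i, (k⁻¹ * g).1 *ᵥ p i = p i := fun i => by
    rw [mul_mulVec, hgk, ← mul_mulVec, inv_mul_cancel, Submonoid.coe_one, one_mulVec]
  rw [Submonoid.coe_one, one_mulVec, ← sub_eq_zero]
  refine hp.eq_zero _ fun i => ?_
  rw [map_sub, LinearMap.sub_apply]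
  nth_rw 1 [← hfix i]
  rw [form_mulVec, sub_self]

theorem transvection_pair_mulVec (hp : IsFrame p) {a b : ι} (hab : a ≠ b) (i : ι) :
    (transvection (p a + p b)).1 *ᵥ p i = p (Equiv.swap a b i) := by
  rw [transvection_mulVec, map_add, hp.form_eq, hp.form_eq]
  rcases eq_or_ne i a with rfl | ha
  · rw [if_pos rfl, if_neg hab, zero_add, one_smul, ← add_assoc, ZModModule.add_self, zero_add,
      Equiv.swap_apply_left]
  rcases eq_or_ne i b with rfl | hb
  · rw [if_pos rfl, if_neg ha, add_zero, one_smul, add_comm (p a), ← add_assoc,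
      ZModModule.add_self, zero_add, Equiv.swap_apply_right]
  · rw [if_neg ha, if_neg hb, CharTwo.add_self_eq_zero, zero_smul, add_zero,
      Equiv.swap_apply_of_ne_of_ne ha hb]

theorem exists_perm [Fintype ι] (hp : IsFrame p) (τ : Equiv.Perm ι) :
    ∃ g : symplecticGroup l (ZMod 2), ∀ i, g.1 *ᵥ p i = p (τ i) := by
  induction τ using Equiv.Perm.swap_induction_on with
  | one => exact ⟨1, fun i => by simp⟩
  | swap_mul f a b hab ih =>
    obtain ⟨g, hg⟩ := ih
    refine ⟨transvection (p a + p b) * g, fun i => ?_⟩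
    rw [mul_mulVec, hg, hp.transvection_pair_mulVec hab, Equiv.Perm.mul_apply]

theorem pow_eq_one (hp : IsFrame p) {T : symplecticGroup l (ZMod 2)} {σ : Equiv.Perm ι}
    (hT : ∀ i, T.1 *ᵥ p i = p (σ i)) {n : ℕ} (hσ : σ ^ n = 1) : T ^ n = 1 := by
  have hpow : ∀ m : ℕ, ∀ i, (T ^ m).1 *ᵥ p i = p ((σ ^ m) i) := fun m => by
    induction m with
    | zero => intro i; simp
    | succ m ih =>
      intro i
      rw [pow_succ', mul_mulVec, ih, hT, pow_succ', Equiv.Perm.mul_apply]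
  refine hp.ext fun i => ?_
  rw [hpow, hσ]
  simp

variable {H : Subgroup (symplecticGroup l (ZMod 2))}

theorem exists_perm_mem [Fintype ι] (hp : IsFrame p) {T : symplecticGroup l (ZMod 2)}
    {σ : Equiv.Perm ι} (hσ : σ.IsCycle) (hsupp : σ.support = Finset.univ) (hT : ∀ i, T.1 *ᵥ p i = p (σ i))
    (hTH : T ∈ H) {a : ι} (ha : transvection (p a + p (σ a)) ∈ H) (τ : Equiv.Perm ι) :
    ∃ g ∈ H, ∀ i, g.1 *ᵥ p i = p (τ i) := by
  have hτ : τ ∈ Subgroup.closure ({σ, Equiv.swap a (σ a)} : Set (Equiv.Perm ι)) := by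
    rw [Equiv.Perm.closure_cycle_adjacent_swap hσ hsupp a]
    exact Subgroup.mem_top τ
  have hne : a ≠ σ a := fun h => by
    have := Finset.mem_univ a
    rw [← hsupp, Equiv.Perm.mem_support] at this
    exact this h.symm
  induction hτ using Subgroup.closure_induction with
  | mem τ h =>
    rcases h with rfl | rfl
    · exact ⟨T, hTH, hT⟩
    · exact ⟨_, ha, hp.transvection_pair_mulVec hne⟩
  | one => exact ⟨1, H.one_mem, fun i => by simp⟩
  | mul τ₁ τ₂ _ _ h₁ h₂ =>
    obtain ⟨g₁, hg₁, h₁⟩ := h₁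
    obtain ⟨g₂, hg₂, h₂⟩ := h₂
    exact ⟨g₁ * g₂, H.mul_mem hg₁ hg₂, fun i => by
      rw [mul_mulVec, h₂, h₁, Equiv.Perm.mul_apply]⟩
  | inv τ _ h =>
    obtain ⟨g, hg, h⟩ := h
    refine ⟨g⁻¹, H.inv_mem hg, fun i => ?_⟩
    have := h (τ⁻¹ i)
    rw [← Equiv.Perm.mul_apply, mul_inv_cancel, Equiv.Perm.one_apply] at this
    rw [← this, ← mul_mulVec, inv_mul_cancel, Submonoid.coe_one, one_mulVec]

theorem transvection_sum_mem_of_card_eq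
    (hperm : ∀ τ : Equiv.Perm ι, ∃ g ∈ H, ∀ i, g.1 *ᵥ p i = p (τ i)) {s t : Finset ι}
    (hs : transvection (∑ i ∈ s, p i) ∈ H) (hst : t.card = s.card) :
    transvection (∑ i ∈ t, p i) ∈ H := by
  obtain ⟨τ, hτ⟩ := (Set.powersetCard.isPretransitive (α := ι) (n := s.card)).exists_smul_eq
    ⟨s, rfl⟩ ⟨t, hst⟩
  replace hτ : s.image τ = t := congrArg Subtype.val hτ
  obtain ⟨g, hg, hgp⟩ := hperm τ
  have := transvection_mulVec_mem hg hs
  rwa [mulVec_sum, Finset.sum_congr rfl fun i _ => hgp i,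
    ← Finset.sum_image (f := p) (g := τ) τ.injective.injOn, hτ] at this

theorem eq_top [Fintype ι] (hp : IsFrame p) (hodd : Odd (Fintype.card ι))
    (hperm : ∀ τ : Equiv.Perm ι, ∃ g ∈ H, ∀ i, g.1 *ᵥ p i = p (τ i)) {s₂ s₄ : Finset ι}
    (hs₂ : s₂.card = 2) (hs₄ : s₄.card = 4) (h₂ : transvection (∑ i ∈ s₂, p i) ∈ H)
    (h₄ : transvection (∑ i ∈ s₄, p i) ∈ H) : H = ⊤ := by
  refine eq_top_of_transvection_mem fun v => ?_
  obtain ⟨s, hs, rfl⟩ := hp.exists_eq_sum hodd v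
  induction hn : s.card using Nat.strong_induction_on generalizing s with
  | _ n ih =>
  subst hn
  by_cases hc0 : s.card = 0
  · rw [Finset.card_eq_zero.1 hc0, Finset.sum_empty, transvection_zero]
    exact H.one_mem
  by_cases hc2 : s.card = 2
  · exact transvection_sum_mem_of_card_eq hperm h₂ (hc2.trans hs₂.symm)
  by_cases hc4 : s.card = 4
  · exact transvection_sum_mem_of_card_eq hperm h₄ (hc4.trans hs₄.symm)
  obtain ⟨x, hx⟩ : ∃ x, x ∉ s := by
    by_contra! h
    rw [Finset.eq_univ_of_forall h, Finset.card_univ] at hs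
    exact Nat.not_even_iff_odd.2 hodd hs
  obtain ⟨q, hqs, hq⟩ := Finset.exists_subset_card_eq (s := s) (n := 3) (by grind)
  have hxq : x ∉ q := fun h => hx (hqs h)
  have hxr : x ∉ s \ q := fun h => hx (Finset.sdiff_subset h)
  have hcr : (insert x (s \ q)).card = s.card - 2 := by
    rw [Finset.card_insert_of_notMem hxr, Finset.card_sdiff_of_subset hqs, hq]
    grind
  have heven : Even (insert x (s \ q)).card := by
    rw [hcr]
    grind
  have hcq : (insert x q).card = 4 := by rw [Finset.card_insert_of_notMem hxq, hq]
  have hsum : ∑ i ∈ s, p i = ∑ i ∈ insert x (s \ q), p i + ∑ i ∈ insert x q, p i := by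
    rw [Finset.sum_insert hxr, Finset.sum_insert hxq, ← Finset.sum_sdiff hqs,
      add_add_add_comm, ZModModule.add_self, zero_add]
  have hlt : (insert x (s \ q)).card < s.card := by omega
  have hr := ih _ hlt _ heven rfl
  have hq' := transvection_sum_mem_of_card_eq hperm h₄ (hcq.trans hs₄.symm)
  rw [hsum]
  refine transvection_add_mem hr hq' ?_
  rw [hp.form_sum_sum heven, ← Finset.insert_inter_distrib, Finset.sdiff_inter_self]
  simp

/-- An `n`-cycle on a frame, together with a product of a transposition and a commuting element of
order three, generate the symplectic group. -/
theorem exists_generators [Fintype ι] (hp : IsFrame p) (hodd : Odd (Fintype.card ι))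
    {σ : Equiv.Perm ι} (hσ : σ.IsCycle) (hsupp : σ.support = Finset.univ) (hcard : 7 ≤ Fintype.card ι) :
    ∃ S T : symplecticGroup l (ZMod 2), T ^ Fintype.card ι = 1 ∧
      Subgroup.closure ({S, T} : Set (symplecticGroup l (ZMod 2))) = ⊤ := by
  obtain ⟨a, ha, -⟩ := id hσ
  obtain ⟨T, hT⟩ := hp.exists_perm σ
  have hs₂ : ({a, σ a} : Finset ι).card = 2 := Finset.card_pair (Ne.symm ha)
  obtain ⟨r, hr, hr5⟩ := Finset.exists_subset_card_eq (s := ({a, σ a} : Finset ι)ᶜ) (n := 5)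
    (by rw [Finset.card_compl, hs₂]; omega)
  obtain ⟨b, hb⟩ : r.Nonempty := Finset.card_pos.1 (by omega)
  have hr4 : (r.erase b).card = 4 := by rw [Finset.card_erase_of_mem hb, hr5]
  obtain ⟨c, hc⟩ : (r.erase b).Nonempty := Finset.card_pos.1 (by omega)
  have hbc : b ≠ c := (Finset.ne_of_mem_erase hc).symm
  have hdisj : ∀ t ⊆ r, form (∑ i ∈ {a, σ a}, p i) (∑ i ∈ t, p i) = 0 := fun t ht => by
    have : Disjoint {a, σ a} t := Finset.subset_compl_iff_disjoint_left.1 (ht.trans hr)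
    rw [hp.form_sum_sum (by rw [hs₂]; exact even_two), Finset.disjoint_iff_inter_eq_empty.1 this,
      Finset.card_empty, Nat.cast_zero]
  have hform : form (∑ i ∈ {b, c}, p i) (∑ i ∈ r.erase b, p i) = 1 := by
    rw [hp.form_sum_sum (by rw [Finset.card_pair hbc]; exact even_two),
      Finset.insert_inter_of_notMem (Finset.notMem_erase b r),
      Finset.singleton_inter_of_mem hc, Finset.card_singleton, Nat.cast_one]
  have hbr : {b, c} ⊆ r :=
    Finset.insert_subset hb (Finset.singleton_subset_iff.2 (Finset.mem_of_mem_erase hc))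
  set t := transvection (∑ i ∈ {a, σ a}, p i) with ht
  set u := transvection (∑ i ∈ {b, c}, p i)
  set v := transvection (∑ i ∈ r.erase b, p i)
  have hcomm : Commute t (u * v) :=
    (transvection_commute (hdisj _ hbr)).mul_right
      (transvection_commute (hdisj _ (Finset.erase_subset b r)))
  have hpow : (t * (u * v)) ^ 3 = t := by
    rw [hcomm.mul_pow, transvection_mul_pow_three hform, mul_one, pow_succ, pow_two,
      transvection_mul_self, one_mul]
  refine ⟨t * (u * v), T, hp.pow_eq_one hT ?_, ?_⟩
  · rw [← Finset.card_univ, ← hsupp, ← hσ.orderOf, pow_orderOf_eq_one]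
  set H := Subgroup.closure ({t * (u * v), T} : Set (symplecticGroup l (ZMod 2)))
  have hSH : t * (u * v) ∈ H := Subgroup.subset_closure (Set.mem_insert _ _)
  have hTH : T ∈ H := Subgroup.subset_closure (Set.mem_insert_of_mem _ rfl)
  have htH : t ∈ H := hpow ▸ H.pow_mem hSH 3
  have hperm := hp.exists_perm_mem hσ hsupp hT hTH (a := a)
    (by rwa [ht, Finset.sum_pair (Ne.symm ha)] at htH)
  have huH : u ∈ H :=
    transvection_sum_mem_of_card_eq hperm htH ((Finset.card_pair hbc).trans hs₂.symm)
  have hvH : v ∈ H := (H.mul_mem_cancel_left huH).1 ((H.mul_mem_cancel_left htH).1 hSH)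
  exact hp.eq_top hodd hperm hs₂ hr4 htH hvH

end IsFrame

/-- The Jordan–Wigner vectors: position `j` holds `(1, 1)` for `2 * j + 1 < m`, and `(1, 0)` or
`(0, 1)` at `j = m / 2`, according to the parity of `m`. -/
def frameVector (h m : ℕ) : Fin h ⊕ Fin h → ZMod 2 :=
  Sum.elim (fun j => if (j : ℕ) < m / 2 ∨ 2 * (j : ℕ) = m then 1 else 0)
    fun j => if (j : ℕ) < m / 2 ∨ 2 * (j : ℕ) + 1 = m then 1 else 0

theorem form_frameVector {h m n : ℕ} (hmn : m < n) (hn : n ≤ 2 * h) :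
    form (frameVector h m) (frameVector h n) = 1 := by
  rw [form_apply, Finset.sum_eq_single (⟨m / 2, by omega⟩ : Fin h)]
  · simp only [frameVector, Sum.elim_inl, Sum.elim_inr]
    split_ifs <;> first | omega | decide
  · intro j _ hj
    have hj' : (j : ℕ) ≠ m / 2 := fun h => hj (Fin.ext h)
    simp only [frameVector, Sum.elim_inl, Sum.elim_inr]
    split_ifs <;> first | omega | decide
  · simp

theorem isFrame_frameVector (h : ℕ) :
    IsFrame fun i : Fin (2 * h + 1) => frameVector h i where
  form_eq i j := by
    rcases lt_trichotomy i j with hij | rfl | hij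
    · rw [if_neg hij.ne, form_frameVector hij (by omega)]
    · rw [if_pos rfl, form_self]
    · rw [if_neg hij.ne', form_comm, form_frameVector hij (by omega)]
  eq_zero x hx := by
    have hx' : ∀ m ≤ 2 * h, form x (frameVector h m) = 0 := fun m hm => hx ⟨m, by omega⟩
    have hpair : ∀ k : Fin h, x (Sum.inl k) = x (Sum.inr k) := fun k => by
      obtain ⟨m, hm⟩ : ∃ m, m = 2 * (k : ℕ) := ⟨_, rfl⟩
      have hsum : form x (frameVector h m + frameVector h (m + 1)) = 0 := by
        rw [map_add, hx' m (by omega), hx' (m + 1) (by omega), add_zero]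
      rw [form_apply, Finset.sum_eq_single k] at hsum
      · rw [← CharTwo.add_eq_zero, ← hsum]
        simp only [frameVector, Pi.add_apply, Sum.elim_inl, Sum.elim_inr]
        split_ifs <;> first | omega | ring1
      · intro j _ hj
        have hj' : (j : ℕ) ≠ k := fun h => hj (Fin.ext h)
        simp only [frameVector, Pi.add_apply, Sum.elim_inl, Sum.elim_inr]
        split_ifs <;> first | omega | ring1 | (ring_nf; reduce_mod_char)
      · simp
    have hinr : ∀ k : Fin h, x (Sum.inr k) = 0 := fun k => by
      obtain ⟨m, hm⟩ : ∃ m, m = 2 * (k : ℕ) := ⟨_, rfl⟩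
      have hsum := hx' m (by omega)
      rw [form_apply, Finset.sum_eq_single k] at hsum
      · rw [← hsum]
        simp only [frameVector, Sum.elim_inl, Sum.elim_inr]
        split_ifs <;> first | omega | ring1
      · intro j _ hj
        have hj' : (j : ℕ) ≠ k := fun h => hj (Fin.ext h)
        rw [hpair]
        simp only [frameVector, Sum.elim_inl, Sum.elim_inr]
        split_ifs <;> first | omega | ring1 | (ring_nf; reduce_mod_char)
      · simp
    ext (k | k)
    · rw [hpair, hinr, Pi.zero_apply]
    · rw [hinr, Pi.zero_apply]

end Frames

end SymplecticGroup

/-- For every natural number `h ≥ 9`, the symplectic group `Sp(2h; ℤ/2ℤ)`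
is generated by two elements, one of which has order dividing `2h+1`. -/
theorem sp_two_generators_order (h : ℕ) (hh : 9 ≤ h) :
    ∃ S T : Matrix.symplecticGroup (Fin h) (ZMod 2),
      T ^ (2 * h + 1) = 1 ∧
      Subgroup.closure ({S, T} : Set (Matrix.symplecticGroup (Fin h) (ZMod 2))) = ⊤ := by
  have := (SymplecticGroup.isFrame_frameVector h).exists_generators
    (by rw [Fintype.card_fin]; exact odd_two_mul_add_one h)
    (isCycle_finRotate_of_le (by omega)) (support_finRotate_of_le (by omega))
    (by rw [Fintype.card_fin]; omega)
  rwa [Fintype.card_fin] at this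
end

section
/- For every natural number h with h ≥ 13 (equivalently, for every odd integer g = 2h+1 ≥ 27), the symplectic group Sp(2h; Z/2Z) is generated by three involutions; that is, there exist matrices R₁, R₂, R₃ in Sp(2h; Z/2Z), each satisfying Rᵢ² = 1, such that the subgroup of Sp(2h; Z/2Z) generated by {R₁, R₂, R₃} is the whole group. -/
open Matrix

namespace SymplecticTwo

variable {l : Type*} [Fintype l] [DecidableEq l]

lemma eq_one_of_ne_zero {c : ZMod 2} (hc : c ≠ 0) : c = 1 := by
  revert c
  decide

/-- The standard symplectic form over the field with two elements. -/
def form (x y : l ⊕ l → ZMod 2) : ZMod 2 := x ⬝ᵥ (J l (ZMod 2) *ᵥ y)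

lemma form_eq_sum (x y : l ⊕ l → ZMod 2) :
    form x y = ∑ j, (x (.inl j) * y (.inr j) + x (.inr j) * y (.inl j)) := by
  simp [form, J, dotProduct, Finset.sum_add_distrib, fromBlocks_mulVec, ZModModule.neg_eq_self]

lemma form_add_left (x y z : l ⊕ l → ZMod 2) : form (x + y) z = form x z + form y z := by
  simp [form]

lemma form_add_right (x y z : l ⊕ l → ZMod 2) : form x (y + z) = form x y + form x z := by
  simp [form, mulVec_add]

lemma form_smul_left (c : ZMod 2) (x y : l ⊕ l → ZMod 2) : form (c • x) y = c * form x y := by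
  simp [form]

lemma form_smul_right (c : ZMod 2) (x y : l ⊕ l → ZMod 2) : form x (c • y) = c * form x y := by
  simp [form, mulVec_smul]

lemma form_sum_left {ι : Type*} (s : Finset ι) (f : ι → l ⊕ l → ZMod 2) (y : l ⊕ l → ZMod 2) :
    form (∑ i ∈ s, f i) y = ∑ i ∈ s, form (f i) y := by
  simp [form, sum_dotProduct]

lemma form_sum_right {ι : Type*} (s : Finset ι) (f : ι → l ⊕ l → ZMod 2) (y : l ⊕ l → ZMod 2) :
    form y (∑ i ∈ s, f i) = ∑ i ∈ s, form y (f i) := by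
  simp [form, mulVec_sum, dotProduct_sum]

lemma form_comm (x y : l ⊕ l → ZMod 2) : form x y = form y x := by
  simp only [form_eq_sum]
  exact Finset.sum_congr rfl fun j _ ↦ by ring

lemma form_self (x : l ⊕ l → ZMod 2) : form x x = 0 := by
  rw [form_eq_sum]
  exact Finset.sum_eq_zero fun j _ ↦ by rw [mul_comm, CharTwo.add_self_eq_zero]

lemma exists_form_eq_one {x : l ⊕ l → ZMod 2} (hx : x ≠ 0) : ∃ y, form y x = 1 := by
  obtain ⟨i, hi⟩ := Function.ne_iff.mp hx
  have h1 : x i = 1 := eq_one_of_ne_zero hi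
  cases i with
  | inl j => exact ⟨Pi.single (.inr j) 1, by simp [form_eq_sum, Pi.single_apply, h1]⟩
  | inr j => exact ⟨Pi.single (.inl j) 1, by simp [form_eq_sum, Pi.single_apply, h1]⟩

lemma form_mulVec (M : symplecticGroup l (ZMod 2)) (x y : l ⊕ l → ZMod 2) :
    form (M.1 *ᵥ x) (M.1 *ᵥ y) = form x y := by
  have h := SymplecticGroup.mem_iff'.mp M.2
  rw [form, form, ← vecMul_transpose, ← dotProduct_mulVec, mulVec_mulVec, mulVec_mulVec, h]

lemma mem_symplecticGroup_of_form {M : Matrix (l ⊕ l) (l ⊕ l) (ZMod 2)}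
    (hM : ∀ x y, form (M *ᵥ x) (M *ᵥ y) = form x y) : M ∈ symplecticGroup l (ZMod 2) := by
  rw [SymplecticGroup.mem_iff']
  ext i j
  have h := hM (Pi.single i 1) (Pi.single j 1)
  rw [form, form, ← vecMul_transpose, ← dotProduct_mulVec, mulVec_mulVec, mulVec_mulVec] at h
  simpa using h

lemma ext_mulVec {M N : symplecticGroup l (ZMod 2)} (h : ∀ x, M.1 *ᵥ x = N.1 *ᵥ x) : M = N :=
  Subtype.ext (Matrix.ext_of_mulVec_single fun _ ↦ h _)

/-- The symplectic group element with a given form-preserving linear map. -/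
def ofLinearMap (φ : (l ⊕ l → ZMod 2) →ₗ[ZMod 2] (l ⊕ l → ZMod 2))
    (hφ : ∀ x y, form (φ x) (φ y) = form x y) : symplecticGroup l (ZMod 2) :=
  ⟨φ.toMatrix', mem_symplecticGroup_of_form fun x y ↦ by simp [hφ]⟩

lemma ofLinearMap_mulVec (φ : (l ⊕ l → ZMod 2) →ₗ[ZMod 2] (l ⊕ l → ZMod 2))
    (hφ : ∀ x y, form (φ x) (φ y) = form x y) (x : l ⊕ l → ZMod 2) :
    (ofLinearMap φ hφ).1 *ᵥ x = φ x := by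
  simp [ofLinearMap]

/-- The symplectic transvection along `u`. -/
def transv (u : l ⊕ l → ZMod 2) : symplecticGroup l (ZMod 2) :=
  ofLinearMap
    { toFun := fun x ↦ x + form u x • u
      map_add' := fun x y ↦ by rw [form_add_right]; module
      map_smul' := fun c x ↦ by simp only [form_smul_right, RingHom.id_apply]; module }
    fun x y ↦ by
      simp only [LinearMap.coe_mk, AddHom.coe_mk, form_add_left, form_add_right, form_smul_left,
        form_smul_right, form_self, form_comm x u]
      linear_combination CharTwo.add_self_eq_zero (form u x * form u y)

@[simp]
lemma transv_mulVec (u x : l ⊕ l → ZMod 2) : (transv u).1 *ᵥ x = x + form u x • u :=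
  ofLinearMap_mulVec _ _ _

lemma coe_mul_mulVec (M N : symplecticGroup l (ZMod 2)) (x : l ⊕ l → ZMod 2) :
    (M * N).1 *ᵥ x = M.1 *ᵥ (N.1 *ᵥ x) := by
  simp

lemma transv_zero : transv (0 : l ⊕ l → ZMod 2) = 1 :=
  ext_mulVec fun x ↦ by simp

lemma transv_sq (u : l ⊕ l → ZMod 2) : transv u ^ 2 = 1 :=
  ext_mulVec fun x ↦ by
    rw [sq, coe_mul_mulVec]
    simp [form_add_right, form_smul_right, form_self, add_assoc, ZModModule.add_self]

lemma conj_transv (M : symplecticGroup l (ZMod 2)) (u : l ⊕ l → ZMod 2) :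
    M * transv u * M⁻¹ = transv (M.1 *ᵥ u) := by
  rw [mul_inv_eq_iff_eq_mul]
  refine ext_mulVec fun x ↦ ?_
  simp only [coe_mul_mulVec, transv_mulVec, mulVec_add, mulVec_smul, form_mulVec]

lemma transv_mulVec_mem {G : Subgroup (symplecticGroup l (ZMod 2))}
    {M : symplecticGroup l (ZMod 2)} (hM : M ∈ G) {u : l ⊕ l → ZMod 2} (hu : transv u ∈ G) :
    transv (M.1 *ᵥ u) ∈ G := by
  rw [← conj_transv]
  exact G.mul_mem (G.mul_mem hM hu) (G.inv_mem hM)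

lemma transv_add_mem {G : Subgroup (symplecticGroup l (ZMod 2))} {u w : l ⊕ l → ZMod 2}
    (hu : transv u ∈ G) (hw : transv w ∈ G) (h : form u w = 1) : transv (u + w) ∈ G := by
  simpa [h, add_comm] using transv_mulVec_mem hu hw

/-- The vectors moved by a symplectic matrix. -/
def moved (M : symplecticGroup l (ZMod 2)) : Finset (l ⊕ l → ZMod 2) :=
  {x | M.1 *ᵥ x ≠ x}

lemma mem_moved {M : symplecticGroup l (ZMod 2)} {x : l ⊕ l → ZMod 2} :
    x ∈ moved M ↔ M.1 *ᵥ x ≠ x := by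
  simp [moved]

lemma moved_transv_mul_subset (M : symplecticGroup l (ZMod 2)) (y : l ⊕ l → ZMod 2) :
    moved (transv (M.1 *ᵥ y + y) * M) ⊆ moved M := by
  intro x
  rw [mem_moved, mem_moved]
  contrapose
  intro hx
  have h : form (M.1 *ᵥ y) x = form y x := by
    conv_lhs => rw [← hx]
    exact form_mulVec M y x
  simp [hx, ← mulVec_mulVec, form_add_left, h, CharTwo.add_self_eq_zero]

lemma moved_transv_mul_ssubset (M : symplecticGroup l (ZMod 2)) (v : l ⊕ l → ZMod 2)
    (hv : form v (M.1 *ᵥ v) = 1) : moved (transv (M.1 *ᵥ v + v) * M) ⊂ moved M := by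
  refine (Finset.ssubset_iff_of_subset (moved_transv_mul_subset M v)).mpr ⟨v, ?_, ?_⟩
  · rw [mem_moved]
    intro h
    simp [h, form_self] at hv
  · rw [mem_moved, not_not, coe_mul_mulVec, transv_mulVec, form_add_left, form_self, hv,
      zero_add, one_smul, ← add_assoc, ZModModule.add_self, zero_add]

/-- Symplectic transvections generate the symplectic group over the field with two elements. -/
theorem eq_top_of_transv_mem {G : Subgroup (symplecticGroup l (ZMod 2))}
    (hG : ∀ u, transv u ∈ G) : G = ⊤ := by
  rw [eq_top_iff]
  intro M _
  clear * - hG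
  induction hn : (moved M).card using Nat.strong_induction_on generalizing M with
  | _ n ih =>
  subst hn
  by_cases hex : ∃ v, form v (M.1 *ᵥ v) = 1
  · obtain ⟨v, hv⟩ := hex
    exact (G.mul_mem_cancel_left (hG _)).mp
      (ih _ (Finset.card_lt_card (moved_transv_mul_ssubset M v hv)) rfl)
  · have hzero : ∀ v, form v (M.1 *ᵥ v) = 0 := fun v ↦ by
      by_contra h
      exact hex ⟨v, eq_one_of_ne_zero h⟩
    by_cases hM : ∀ v, M.1 *ᵥ v = v
    · rw [show M = 1 from ext_mulVec fun v ↦ by simp [hM]]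
      exact G.one_mem
    · push Not at hM
      obtain ⟨v, hv⟩ := hM
      have hne : M.1 *ᵥ v + v ≠ 0 := fun h ↦ hv (by
        rwa [← ZModModule.sub_eq_add, sub_eq_zero] at h)
      obtain ⟨y, hy⟩ := exists_form_eq_one hne
      have hpolar : form v (M.1 *ᵥ y) + form y (M.1 *ᵥ v) = 0 := by
        have := hzero (v + y)
        simpa [mulVec_add, form_add_left, form_add_right, hzero, add_comm] using this
      rw [form_add_right] at hy
      have hzv : form (M.1 *ᵥ y + y) v = 1 := by
        rw [form_add_left, form_comm _ v]
        linear_combination hpolar + hy - CharTwo.add_self_eq_zero (form y (M.1 *ᵥ v))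
      have hzMv : form (M.1 *ᵥ y + y) (M.1 *ᵥ v) = 1 := by
        rw [form_add_left, form_mulVec]
        linear_combination hy
      set N := transv (M.1 *ᵥ y + y) * M with hN
      have hvN : form v (N.1 *ᵥ v) = 1 := by
        rw [hN, coe_mul_mulVec, transv_mulVec, form_add_right, form_smul_right, hzero, hzMv,
          form_comm, hzv]
        simp
      have hcard := (Finset.card_lt_card (moved_transv_mul_ssubset N v hvN)).trans_le
        (Finset.card_le_card (moved_transv_mul_subset M y))
      exact (G.mul_mem_cancel_left (hG _)).mp
        ((G.mul_mem_cancel_left (hG _)).mp (ih _ hcard rfl))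

/-- A family of vectors spanning the symplectic space, with sum zero and with distinct members
pairing to one. -/
structure IsSimplex {ι : Type*} [Fintype ι] (f : ι → l ⊕ l → ZMod 2) : Prop where
  form_eq_one : ∀ ⦃i j⦄, i ≠ j → form (f i) (f j) = 1
  sum_eq_zero : ∑ i, f i = 0
  span_eq_top : Submodule.span (ZMod 2) (Set.range f) = ⊤

namespace IsSimplex

variable {ι : Type*} [Fintype ι] {f : ι → l ⊕ l → ZMod 2}

lemma comp_equiv (hf : IsSimplex f) {κ : Type*} [Fintype κ] (e : κ ≃ ι) : IsSimplex (f ∘ e) where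
  form_eq_one _ _ hij := hf.form_eq_one (e.injective.ne hij)
  sum_eq_zero := by simpa using (e.sum_comp f).trans hf.sum_eq_zero
  span_eq_top := by rw [e.surjective.range_comp, hf.span_eq_top]

variable [DecidableEq ι]

lemma form_eq (hf : IsSimplex f) (i j : ι) : form (f i) (f j) = 1 + if i = j then 1 else 0 := by
  split_ifs with h
  · rw [h, form_self]; rfl
  · rw [hf.form_eq_one h, add_zero]

lemma sum_form_smul (hf : IsSimplex f) {E : Type*} [AddCommGroup E] [Module (ZMod 2) E]
    {g : ι → E} (hg : ∑ i, g i = 0) (j : ι) : ∑ i, form (f i) (f j) • g i = g j := by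
  simp [hf.form_eq, add_smul, Finset.sum_add_distrib, hg, ite_smul]

lemma expand (hf : IsSimplex f) (x : l ⊕ l → ZMod 2) : ∑ i, form (f i) x • f i = x := by
  have hx : x ∈ Submodule.span (ZMod 2) (Set.range f) := hf.span_eq_top ▸ Submodule.mem_top
  induction hx using Submodule.span_induction with
  | mem x hx =>
    obtain ⟨j, rfl⟩ := hx
    exact hf.sum_form_smul hf.sum_eq_zero j
  | zero => simp [form]
  | add x y _ _ hx hy => simp [form_add_right, add_smul, Finset.sum_add_distrib, hx, hy]
  | smul c x _ hx => simp [form_smul_right, mul_smul, ← Finset.smul_sum, hx]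

/-- The symplectic matrix permuting the members of the family. -/
def perm (hf : IsSimplex f) (σ : Equiv.Perm ι) : symplecticGroup l (ZMod 2) :=
  ofLinearMap
    { toFun := fun x ↦ ∑ i, form (f i) x • f (σ i)
      map_add' := fun x y ↦ by simp [form_add_right, add_smul, Finset.sum_add_distrib]
      map_smul' := fun c x ↦ by simp [form_smul_right, mul_smul, Finset.smul_sum] }
    fun x y ↦ by
      conv_rhs => rw [← hf.expand x, ← hf.expand y]
      simp only [LinearMap.coe_mk, AddHom.coe_mk, form_sum_left, form_sum_right, form_smul_left,
        form_smul_right, hf.form_eq, σ.injective.eq_iff]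

lemma perm_mulVec (hf : IsSimplex f) (σ : Equiv.Perm ι) (i : ι) :
    (hf.perm σ).1 *ᵥ f i = f (σ i) := by
  rw [perm, ofLinearMap_mulVec]
  exact hf.sum_form_smul (g := fun i ↦ f (σ i)) ((Equiv.sum_comp σ f).trans hf.sum_eq_zero) i

lemma perm_sq (hf : IsSimplex f) {σ : Equiv.Perm ι} (hσ : Function.Involutive σ) :
    hf.perm σ ^ 2 = 1 := by
  refine ext_mulVec fun x ↦ ?_
  rw [← hf.expand x, sq]
  simp only [coe_mul_mulVec, mulVec_sum, mulVec_smul, perm_mulVec, hσ _, OneMemClass.coe_one,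
    one_mulVec]

lemma form_sum_sum (hf : IsSimplex f) (S T : Finset ι) :
    form (∑ i ∈ S, f i) (∑ i ∈ T, f i) = S.card * T.card + (S ∩ T).card := by
  rw [form_sum_left]
  simp [form_sum_right, hf.form_eq, Finset.sum_add_distrib, Finset.sum_ite_mem]

variable {G : Subgroup (symplecticGroup l (ZMod 2))}

lemma transv_pair_trans (hf : IsSimplex f) {i j k : ι} (hij : transv (f i + f j) ∈ G)
    (hjk : transv (f j + f k) ∈ G) : transv (f i + f k) ∈ G := by
  by_cases h1 : i = j
  · rwa [h1]
  by_cases h2 : j = k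
  · rwa [← h2]
  by_cases h3 : i = k
  · rw [h3, ZModModule.add_self, transv_zero]
    exact G.one_mem
  have h : form (f i + f j) (f j + f k) = 1 := by
    simp only [form_add_left, form_add_right, hf.form_eq, h1, h2, h3, if_true, if_false]
    decide
  have := transv_add_mem hij hjk h
  rwa [add_assoc, ← add_assoc (f j), ZModModule.add_self, zero_add] at this

lemma transv_exchange (hf : IsSimplex f) (hpair : ∀ i j, transv (f i + f j) ∈ G) {S : Finset ι}
    (hS : transv (∑ i ∈ S, f i) ∈ G) (heven : Even S.card) {i j : ι} (hi : i ∈ S) (hj : j ∉ S) :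
    transv (∑ k ∈ insert j (S.erase i), f k) ∈ G := by
  have hij : i ≠ j := fun h ↦ hj (h ▸ hi)
  have h : form (f i + f j) (∑ i ∈ S, f i) = 1 := by
    have := hf.form_sum_sum {i, j} S
    rwa [Finset.sum_pair hij, (CharP.cast_eq_zero_iff (ZMod 2) 2 S.card).mpr heven.two_dvd,
      mul_zero, zero_add, Finset.insert_inter_of_mem hi, Finset.singleton_inter_of_notMem hj,
      insert_empty_eq, Finset.card_singleton, Nat.cast_one] at this
  convert transv_add_mem (hpair i j) hS h using 2
  rw [Finset.sum_insert (by simp [hj]), ← Finset.add_sum_erase S f hi, add_comm (f i) (f j),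
    add_assoc, ← add_assoc (f i), ZModModule.add_self, zero_add]

lemma transv_of_card_eq (hf : IsSimplex f) (hpair : ∀ i j, transv (f i + f j) ∈ G)
    {S T : Finset ι} (hS : transv (∑ i ∈ S, f i) ∈ G) (heven : Even S.card)
    (hcard : S.card = T.card) : transv (∑ i ∈ T, f i) ∈ G := by
  induction hn : (T \ S).card generalizing S with
  | zero =>
    have hTS : T ⊆ S := Finset.sdiff_eq_empty_iff_subset.mp (Finset.card_eq_zero.mp hn)
    rwa [Finset.eq_of_subset_of_card_le hTS hcard.le]
  | succ n ih =>
    have hn' : (S \ T).card = n + 1 := by rw [Finset.card_sdiff_comm hcard, hn]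
    obtain ⟨j, hj⟩ : (T \ S).Nonempty := Finset.card_pos.mp (by omega)
    obtain ⟨i, hi⟩ : (S \ T).Nonempty := Finset.card_pos.mp (by omega)
    have hj' := hj
    rw [Finset.mem_sdiff] at hi hj
    have hc : (insert j (S.erase i)).card = S.card := by
      rw [Finset.card_insert_of_notMem (by simp [hj.2]), Finset.card_erase_add_one hi.1]
    refine ih (hf.transv_exchange hpair hS heven hi.1 hj.2) (by rwa [hc]) (hc.trans hcard) ?_
    have : T \ insert j (S.erase i) = (T \ S).erase j := by
      rw [Finset.sdiff_insert]
      congr 1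
      ext k
      have hki : k ∈ T → k ≠ i := fun hk e ↦ hi.2 (e ▸ hk)
      simp only [Finset.mem_sdiff, Finset.mem_erase]
      tauto
    rw [this, Finset.card_erase_of_mem hj', hn, Nat.add_sub_cancel]

lemma transv_of_even_card (hf : IsSimplex f) (hodd : Odd (Fintype.card ι))
    (hpair : ∀ i j, transv (f i + f j) ∈ G)
    (hfour : ∀ S : Finset ι, S.card = 4 → transv (∑ i ∈ S, f i) ∈ G) (S : Finset ι)
    (heven : Even S.card) : transv (∑ i ∈ S, f i) ∈ G := by
  induction hn : S.card using Nat.strong_induction_on generalizing S with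
  | _ n ih =>
  subst hn
  obtain h0 | h2 | h4 | h6 : S.card = 0 ∨ S.card = 2 ∨ S.card = 4 ∨ 6 ≤ S.card := by
    obtain ⟨k, hk⟩ := heven
    omega
  · rw [Finset.card_eq_zero.mp h0, Finset.sum_empty, transv_zero]
    exact G.one_mem
  · obtain ⟨i, j, hij, rfl⟩ := Finset.card_eq_two.mp h2
    rw [Finset.sum_pair hij]
    exact hpair i j
  · exact hfour S h4
  · obtain ⟨p, hp⟩ : ∃ p, p ∉ S := by
      by_contra! h
      rw [Finset.eq_univ_iff_forall.mpr h, Finset.card_univ] at heven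
      exact Nat.not_even_iff_odd.mpr hodd heven
    obtain ⟨Q, hQS, hQ⟩ := Finset.exists_subset_card_eq (show 3 ≤ S.card by omega)
    have hpQ : p ∉ Q := fun h ↦ hp (hQS h)
    have hpR : p ∉ S \ Q := fun h ↦ hp (Finset.mem_sdiff.mp h).1
    have hc : (insert p (S \ Q)).card = S.card - 2 := by
      rw [Finset.card_insert_of_notMem hpR, Finset.card_sdiff_of_subset hQS, hQ]
      omega
    have hc' : (insert p Q).card = 4 := by rw [Finset.card_insert_of_notMem hpQ, hQ]
    have hinter : insert p Q ∩ insert p (S \ Q) = {p} := by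
      ext k
      simp only [Finset.mem_inter, Finset.mem_insert, Finset.mem_sdiff, Finset.mem_singleton]
      tauto
    have hform := hf.form_sum_sum (insert p Q) (insert p (S \ Q))
    rw [hinter, hc', show ((4 : ℕ) : ZMod 2) = 0 from rfl, zero_mul, zero_add,
      Finset.card_singleton, Nat.cast_one] at hform
    have hR := ih _ (by omega) (insert p (S \ Q)) (by rw [hc]; exact heven.tsub even_two) hc
    convert transv_add_mem (hfour _ hc') hR hform using 2
    rw [Finset.sum_insert hpQ, Finset.sum_insert hpR, ← Finset.sum_sdiff hQS]
    linear_combination (exp := 1) - ZModModule.add_self (f p)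

lemma eq_top (hf : IsSimplex f) (hodd : Odd (Fintype.card ι))
    (hpair : ∀ i j, transv (f i + f j) ∈ G) {S : Finset ι} (hS : S.card = 4)
    (hSG : transv (∑ i ∈ S, f i) ∈ G) : G = ⊤ := by
  have hall := hf.transv_of_even_card hodd hpair fun T hT ↦
    hf.transv_of_card_eq hpair hSG (hS ▸ by decide) (hS.trans hT.symm)
  refine eq_top_of_transv_mem fun u ↦ ?_
  have hu : u = ∑ i with form (f i) u = 1, f i := by
    conv_lhs => rw [← hf.expand u]
    rw [Finset.sum_filter]
    refine Finset.sum_congr rfl fun i _ ↦ ?_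
    split_ifs with h
    · rw [h, one_smul]
    · rw [not_imp_comm.mp eq_one_of_ne_zero h, zero_smul]
  rw [hu]
  refine hall _ ?_
  rw [even_iff_two_dvd, ← CharP.cast_eq_zero_iff (ZMod 2) 2]
  have hsum : ∑ i, form (f i) u = 0 := by rw [← form_sum_left, hf.sum_eq_zero]; simp [form]
  rw [← hsum, Finset.card_filter, Nat.cast_sum]
  refine Finset.sum_congr rfl fun i _ ↦ ?_
  generalize form (f i) u = c
  revert c
  decide

end IsSimplex

/-- An explicit simplex of `2h + 1` vectors in the symplectic space of dimension `2h`. -/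
def stdSimplex (h : ℕ) : Option (Fin h ⊕ Fin h) → Fin h ⊕ Fin h → ZMod 2
  | none => 1
  | some (.inl k) => Sum.elim (fun j ↦ if j ≤ k then 1 else 0) (fun j ↦ if j < k then 1 else 0)
  | some (.inr k) => Sum.elim (fun j ↦ if j < k then 1 else 0) (fun j ↦ if j ≤ k then 1 else 0)

lemma sum_eq_one_of_eq_ite {ι : Type*} [Fintype ι] [DecidableEq ι] {g : ι → ZMod 2} (m : ι)
    (hg : ∀ j, g j = if j = m then 1 else 0) : ∑ j, g j = 1 := by
  simp [hg]

lemma isSimplex_stdSimplex (h : ℕ) : IsSimplex (stdSimplex h) where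
  form_eq_one i j hij := by
    have hmin : ∀ a b : Fin h, ∃ m, a ≤ b ∧ m = a ∨ b ≤ a ∧ m = b := fun a b ↦
      (le_total a b).elim (fun hab ↦ ⟨a, .inl ⟨hab, rfl⟩⟩) fun hba ↦ ⟨b, .inr ⟨hba, rfl⟩⟩
    rw [form_eq_sum]
    rcases i with _ | k | k <;> rcases j with _ | k' | k'
    · exact absurd rfl hij
    · refine sum_eq_one_of_eq_ite k' fun j ↦ ?_
      simp only [stdSimplex, Sum.elim_inl, Sum.elim_inr, Pi.one_apply]
      split_ifs <;> first | rfl | (exfalso; omega)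
    · refine sum_eq_one_of_eq_ite k' fun j ↦ ?_
      simp only [stdSimplex, Sum.elim_inl, Sum.elim_inr, Pi.one_apply]
      split_ifs <;> first | rfl | (exfalso; omega)
    · refine sum_eq_one_of_eq_ite k fun j ↦ ?_
      simp only [stdSimplex, Sum.elim_inl, Sum.elim_inr, Pi.one_apply]
      split_ifs <;> first | rfl | (exfalso; omega)
    · have hk : k ≠ k' := fun e ↦ hij (by rw [e])
      obtain ⟨m, hm⟩ := hmin k k'
      refine sum_eq_one_of_eq_ite m fun j ↦ ?_
      simp only [stdSimplex, Sum.elim_inl, Sum.elim_inr]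
      split_ifs <;> first | rfl | (exfalso; omega)
    · obtain ⟨m, hm⟩ := hmin k k'
      refine sum_eq_one_of_eq_ite m fun j ↦ ?_
      simp only [stdSimplex, Sum.elim_inl, Sum.elim_inr]
      split_ifs <;> first | rfl | (exfalso; omega)
    · refine sum_eq_one_of_eq_ite k fun j ↦ ?_
      simp only [stdSimplex, Sum.elim_inl, Sum.elim_inr, Pi.one_apply]
      split_ifs <;> first | rfl | (exfalso; omega)
    · obtain ⟨m, hm⟩ := hmin k k'
      refine sum_eq_one_of_eq_ite m fun j ↦ ?_
      simp only [stdSimplex, Sum.elim_inl, Sum.elim_inr]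
      split_ifs <;> first | rfl | (exfalso; omega)
    · have hk : k ≠ k' := fun e ↦ hij (by rw [e])
      obtain ⟨m, hm⟩ := hmin k k'
      refine sum_eq_one_of_eq_ite m fun j ↦ ?_
      simp only [stdSimplex, Sum.elim_inl, Sum.elim_inr]
      split_ifs <;> first | rfl | (exfalso; omega)
  sum_eq_zero := by
    ext t
    rw [Finset.sum_apply, Fintype.sum_option, Fintype.sum_sum_type, ← Finset.sum_add_distrib]
    rcases t with t | t <;> rw [sum_eq_one_of_eq_ite t]
    · rfl
    · intro j
      simp only [stdSimplex, Sum.elim_inl]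
      split_ifs <;> first | rfl | (exfalso; omega)
    · rfl
    · intro j
      simp only [stdSimplex, Sum.elim_inr]
      split_ifs <;> first | rfl | (exfalso; omega)
  span_eq_top := by
    set W := Submodule.span (ZMod 2) (Set.range (stdSimplex h))
    have hmem : ∀ i, stdSimplex h i ∈ W := fun i ↦ Submodule.subset_span ⟨i, rfl⟩
    have hsum : ∀ k : Fin h, ∑ j with j < k,
        (stdSimplex h (some (.inl j)) + stdSimplex h (some (.inr j))) ∈ W :=
      fun k ↦ W.sum_mem fun j _ ↦ W.add_mem (hmem _) (hmem _)
    have hpair : ∀ k : Fin h, stdSimplex h (some (.inl k)) + stdSimplex h (some (.inr k)) =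
        Pi.single (.inl k) 1 + Pi.single (.inr k) 1 := by
      intro k
      ext t
      rcases t with t | t <;>
      · simp only [stdSimplex, Pi.add_apply, Sum.elim_inl, Sum.elim_inr, Pi.single_apply,
          Sum.inl.injEq, Sum.inr.injEq, reduceCtorEq, if_false]
        split_ifs <;> first | rfl | (exfalso; omega)
    simp only [hpair] at hsum
    have hsingle : ∀ t, Pi.single t (1 : ZMod 2) ∈ W := by
      rintro (k | k)
      · convert W.add_mem (hmem (some (.inl k))) (hsum k) using 1
        ext t
        rcases t with t | t <;>
        · simp only [stdSimplex, Pi.add_apply, Sum.elim_inl, Sum.elim_inr, Pi.single_apply,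
            Sum.inl.injEq, Sum.inr.injEq, reduceCtorEq, if_false, Finset.sum_apply, add_zero,
            zero_add, Finset.sum_ite_eq, Finset.mem_filter, Finset.mem_univ, true_and]
          split_ifs <;> first | rfl | (exfalso; omega)
      · convert W.add_mem (hmem (some (.inr k))) (hsum k) using 1
        ext t
        rcases t with t | t <;>
        · simp only [stdSimplex, Pi.add_apply, Sum.elim_inl, Sum.elim_inr, Pi.single_apply,
            Sum.inl.injEq, Sum.inr.injEq, reduceCtorEq, if_false, Finset.sum_apply, add_zero,
            zero_add, Finset.sum_ite_eq, Finset.mem_filter, Finset.mem_univ, true_and]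
          split_ifs <;> first | rfl | (exfalso; omega)
    rw [eq_top_iff, ← (Pi.basisFun (ZMod 2) (Fin h ⊕ Fin h)).span_eq, Submodule.span_le]
    rintro _ ⟨t, rfl⟩
    simpa using hsingle t

end SymplecticTwo

open SymplecticTwo

/-- For every natural number `h ≥ 13`, the symplectic group `Sp(2h; ℤ/2ℤ)`
is generated by three involutions. -/
theorem sp_three_involutions (h : ℕ) (hh : 13 ≤ h) :
    ∃ R₁ R₂ R₃ : Matrix.symplecticGroup (Fin h) (ZMod 2),
      R₁ ^ 2 = 1 ∧ R₂ ^ 2 = 1 ∧ R₃ ^ 2 = 1 ∧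
      Subgroup.closure ({R₁, R₂, R₃} : Set (Matrix.symplecticGroup (Fin h) (ZMod 2))) = ⊤ := by
  have hcard : Fintype.card (ZMod (2 * h + 1)) = Fintype.card (Option (Fin h ⊕ Fin h)) := by
    simp [ZMod.card, two_mul]
  set f := stdSimplex h ∘ Fintype.equivOfCardEq hcard
  have hf : IsSimplex f := (isSimplex_stdSimplex h).comp_equiv _
  have hne : ∀ a b : ℕ, a < 5 → b < 5 → ((a : ZMod (2 * h + 1)) = b ↔ a = b) := by
    intro a b ha hb
    rw [ZMod.natCast_eq_natCast_iff', Nat.mod_eq_of_lt (by omega), Nat.mod_eq_of_lt (by omega)]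
  let S : Finset (ZMod (2 * h + 1)) := (Finset.range 4).image (↑)
  have hinj : Set.InjOn (Nat.cast : ℕ → ZMod (2 * h + 1)) (Finset.range 5) := fun a ha b hb ↦
    (hne a b (Finset.mem_range.mp ha) (Finset.mem_range.mp hb)).mp
  have hS : S.card = 4 := Finset.card_image_of_injOn
    (hinj.mono (Finset.coe_subset.mpr (Finset.range_subset_range.mpr (by norm_num))))
  have hsum : ∑ i ∈ S, f i = f 0 + f 1 + f 2 + f 3 := by
    rw [Finset.sum_image (hinj.mono
      (Finset.coe_subset.mpr (Finset.range_subset_range.mpr (by norm_num))))]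
    simp [Finset.sum_range_succ]
  refine ⟨hf.perm (Equiv.neg _), hf.perm (Equiv.subLeft 1), transv (∑ i ∈ S, f i),
    hf.perm_sq neg_neg, hf.perm_sq fun i ↦ by simp, transv_sq _, ?_⟩
  set G := Subgroup.closure {hf.perm (Equiv.neg _), hf.perm (Equiv.subLeft 1),
    transv (∑ i ∈ S, f i)}
  have hrot : hf.perm (Equiv.subLeft 1) * hf.perm (Equiv.neg _) ∈ G :=
    G.mul_mem (Subgroup.subset_closure (by simp)) (Subgroup.subset_closure (by simp))
  have hrotf : ∀ i, (hf.perm (Equiv.subLeft 1) * hf.perm (Equiv.neg _)).1 *ᵥ f i = f (i + 1) := by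
    intro i
    rw [coe_mul_mulVec, hf.perm_mulVec, hf.perm_mulVec, Equiv.neg_apply, Equiv.subLeft_apply,
      sub_neg_eq_add, add_comm]
  have hSG : transv (∑ i ∈ S, f i) ∈ G := Subgroup.subset_closure (by simp)
  have hstart : transv (f 0 + f 4) ∈ G := by
    have hform : form (f 0 + f 1 + f 2 + f 3) (f 1 + f 2 + f 3 + f 4) = 1 := by
      have hne' : ∀ a b : ℕ, a < 5 → b < 5 →
          form (f a) (f b) = 1 + if a = b then 1 else 0 := fun a b ha hb ↦ by
        simp [hf.form_eq, hne a b ha hb]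
      have h0 : f 0 = f (0 : ℕ) := by simp
      have h1 : f 1 = f (1 : ℕ) := by simp
      have h2 : f 2 = f (2 : ℕ) := by simp
      have h3 : f 3 = f (3 : ℕ) := by simp
      have h4 : f 4 = f (4 : ℕ) := by simp
      rw [h0, h1, h2, h3, h4]
      simp only [form_add_left, form_add_right]
      rw [hne' 0 1, hne' 0 2, hne' 0 3, hne' 0 4, hne' 1 1, hne' 1 2, hne' 1 3, hne' 1 4, hne' 2 1,
        hne' 2 2, hne' 2 3, hne' 2 4, hne' 3 1, hne' 3 2, hne' 3 3, hne' 3 4]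
      · decide
      all_goals norm_num
    have hnext := transv_mulVec_mem hrot hSG
    rw [hsum] at hSG hnext
    simp only [mulVec_add, hrotf, zero_add, one_add_one_eq_two, two_add_one_eq_three,
      three_add_one_eq_four] at hnext
    convert transv_add_mem hSG hnext hform using 2
    linear_combination (exp := 1) - ZModModule.add_self (f 1) - ZModModule.add_self (f 2) -
      ZModModule.add_self (f 3)
  have hstep : ∀ m : ℕ, transv (f m + f (m + 4)) ∈ G := by
    intro m
    induction m with
    | zero => simpa using hstart
    | succ m ih =>
      have := transv_mulVec_mem hrot ih
      rw [mulVec_add, hrotf, hrotf, add_right_comm] at this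
      exact_mod_cast this
  have hmul : ∀ (i : ZMod (2 * h + 1)) (m : ℕ), transv (f i + f (i + 4 * m)) ∈ G := by
    intro i m
    induction m with
    | zero => simp [ZModModule.add_self, transv_zero, G.one_mem]
    | succ m ih =>
      refine hf.transv_pair_trans ih ?_
      have := hstep (i + 4 * m).val
      rw [ZMod.natCast_zmod_val] at this
      convert this using 4
      push_cast
      ring
  have hpair : ∀ i j, transv (f i + f j) ∈ G := by
    intro i j
    have := hmul i (h ^ 2 * (j - i) : ZMod (2 * h + 1)).val
    rw [ZMod.natCast_zmod_val] at this
    convert this using 4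
    have hzero : (2 * h + 1 : ZMod (2 * h + 1)) = 0 := by
      exact_mod_cast ZMod.natCast_self (2 * h + 1)
    linear_combination - (j - i) * (2 * h - 1) * hzero
  exact hf.eq_top (by simp [ZMod.card]) hpair hS hSG
end

section
/- For every natural number h with h ≥ 13, the symplectic group Sp(2h; Z/2Z) is generated by three elements R₁, R₂, R₃, each satisfying Rᵢ² = 1, and such that in addition (R₂R₁)^(2h+1) = 1; that is, three involutions two of whose product has order dividing 2h+1 suffice to generate Sp(2h; Z/2Z). -/
open Matrix

/-- The vectors `w` whose orthogonal transvection `x ↦ x + (w ⬝ x) w` lies in the subgroup `H`. -/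
def transvectionVectors {ι : Type*} [Fintype ι] [DecidableEq ι]
    (H : Subgroup (orthogonalGroup ι (ZMod 2))) : Set (ι → ZMod 2) :=
  {w | w ⬝ᵥ w = 0 ∧ ∃ g ∈ H, (g : Matrix ι ι (ZMod 2)) = 1 + vecMulVec w w}

section Transvection

lemma dotProduct_self_eq_sum {ι : Type*} [Fintype ι] (w : ι → ZMod 2) : w ⬝ᵥ w = ∑ i, w i := by
  have key : ∀ a : ZMod 2, a * a = a := by decide
  simp [dotProduct, key]

variable {ι : Type*} [Fintype ι] [DecidableEq ι]

lemma one_add_vecMulVec_mulVec (w x : ι → ZMod 2) :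
    (1 + vecMulVec w w) *ᵥ x = x + (w ⬝ᵥ x) • w := by
  rw [add_mulVec, one_mulVec, vecMulVec_mulVec, op_smul_eq_smul]

lemma one_add_vecMulVec_mem_orthogonalGroup {w : ι → ZMod 2} (hw : w ⬝ᵥ w = 0) :
    1 + vecMulVec w w ∈ orthogonalGroup ι (ZMod 2) := by
  have h2 : vecMulVec w w + vecMulVec w w = 0 := by ext; exact CharTwo.add_self_eq_zero _
  rw [mem_orthogonalGroup_iff, transpose_add, transpose_one, transpose_vecMulVec, mul_add, mul_one,
    add_mul, one_mul, vecMulVec_mul_vecMulVec, hw, zero_smul, vecMulVec_zero, add_zero, add_assoc,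
    h2, add_zero]

lemma orthogonal_mulVec_dotProduct (g : orthogonalGroup ι (ZMod 2)) (x y : ι → ZMod 2) :
    ((g : Matrix ι ι (ZMod 2)) *ᵥ x) ⬝ᵥ ((g : Matrix ι ι (ZMod 2)) *ᵥ y) = x ⬝ᵥ y := by
  rw [dotProduct_mulVec, vecMul_mulVec, (mem_orthogonalGroup_iff' ι (ZMod 2)).1 g.2, vecMul_one]

lemma orthogonal_mulVec_one (g : orthogonalGroup ι (ZMod 2)) :
    (g : Matrix ι ι (ZMod 2)) *ᵥ 1 = 1 := by
  ext i
  have h := congrFun (congrFun ((mem_orthogonalGroup_iff ι (ZMod 2)).1 g.2) i) i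
  rw [mul_apply', Matrix.one_apply_eq] at h
  rw [mulVec, dotProduct_one, ← dotProduct_self_eq_sum]
  exact h

namespace transvectionVectors

variable {H : Subgroup (orthogonalGroup ι (ZMod 2))}

lemma mulVec_mem {g : orthogonalGroup ι (ZMod 2)} (hg : g ∈ H) {w : ι → ZMod 2}
    (hw : w ∈ transvectionVectors H) :
    (g : Matrix ι ι (ZMod 2)) *ᵥ w ∈ transvectionVectors H := by
  obtain ⟨h0, t, ht, htw⟩ := hw
  refine ⟨by rw [orthogonal_mulVec_dotProduct, h0], g * t * g⁻¹,
    H.mul_mem (H.mul_mem hg ht) (H.inv_mem hg), ?_⟩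
  have hinv : ((g⁻¹ : orthogonalGroup ι (ZMod 2)) : Matrix ι ι (ZMod 2)) = (g.1)ᵀ := rfl
  rw [Submonoid.coe_mul, Submonoid.coe_mul, htw, hinv, mul_add, mul_one, add_mul,
    (mem_orthogonalGroup_iff ι (ZMod 2)).1 g.2, mul_vecMulVec, vecMulVec_mul, vecMul_transpose]

lemma zero_mem : (0 : ι → ZMod 2) ∈ transvectionVectors H :=
  ⟨by simp, 1, H.one_mem, by simp⟩

lemma add_mem {u w : ι → ZMod 2} (hu : u ∈ transvectionVectors H)
    (hw : w ∈ transvectionVectors H) (huw : u ⬝ᵥ w = 1) : u + w ∈ transvectionVectors H := by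
  obtain ⟨-, g, hg, hgu⟩ := id hu
  have := mulVec_mem hg hw
  rwa [hgu, one_add_vecMulVec_mulVec, huw, one_smul, add_comm] at this

end transvectionVectors

open transvectionVectors

/-- If all transvections lie in `H`, then so does every orthogonal matrix fixing the standard basis
vectors outside a finite set; proved by induction on that set. -/
lemma mem_of_forall_mem_transvectionVectors {H : Subgroup (orthogonalGroup ι (ZMod 2))}
    (hH : ∀ w : ι → ZMod 2, w ⬝ᵥ w = 0 → w ∈ transvectionVectors H) (s : Finset ι) :
    ∀ A : orthogonalGroup ι (ZMod 2),
      (∀ i ∉ s, (A : Matrix ι ι (ZMod 2)) *ᵥ Pi.single i 1 = Pi.single i 1) → A ∈ H := by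
  induction s using Finset.induction_on with
  | empty =>
    intro A hA
    convert H.one_mem
    ext1
    exact ext_of_mulVec_single fun i => (hA i (by simp)).trans (one_mulVec _).symm
  | insert k s hk ih =>
    intro A hA
    have two (a : ZMod 2) : a ≠ 0 → a = 1 := by revert a; decide
    have hAk (A : orthogonalGroup ι (ZMod 2))
        (hA : ∀ i ∉ insert k s, (A : Matrix ι ι (ZMod 2)) *ᵥ Pi.single i 1 = Pi.single i 1)
        (i : ι) (hi : i ∉ insert k s) :
        ((A : Matrix ι ι (ZMod 2)) *ᵥ Pi.single k 1) i = 0 := by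
      have h1 := orthogonal_mulVec_dotProduct A (Pi.single i 1) (Pi.single k 1)
      rw [hA i hi] at h1
      have : i ≠ k := by grind
      simpa [this] using h1
    -- a transvection moving the image of `k` to `j`
    have step (A : orthogonalGroup ι (ZMod 2))
        (hA : ∀ i ∉ insert k s, (A : Matrix ι ι (ZMod 2)) *ᵥ Pi.single i 1 = Pi.single i 1)
        (j : ι) (hj : j ∈ insert k s)
        (hjA : ((A : Matrix ι ι (ZMod 2)) *ᵥ Pi.single k 1) j = 0) :
        ∃ t ∈ H, (∀ i ∉ insert k s,
          ((t * A : orthogonalGroup ι (ZMod 2)) : Matrix ι ι (ZMod 2)) *ᵥ Pi.single i 1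
            = Pi.single i 1) ∧
          ((t * A : orthogonalGroup ι (ZMod 2)) : Matrix ι ι (ZMod 2)) *ᵥ Pi.single k 1
            = Pi.single j 1 := by
      have hxx := orthogonal_mulVec_dotProduct A (Pi.single k 1) (Pi.single k 1)
      have hxA := hAk A hA
      set x := (A : Matrix ι ι (ZMod 2)) *ᵥ Pi.single k 1 with hx
      have hxx' : x ⬝ᵥ x = 1 := by simpa using hxx
      obtain ⟨-, t, ht, htw⟩ := hH (x + Pi.single j 1) (by
        simp [add_dotProduct, dotProduct_add, hxx', hjA, CharTwo.add_self_eq_zero])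
      refine ⟨t, ht, fun i hi => ?_, ?_⟩
      · rw [Submonoid.coe_mul, ← mulVec_mulVec, hA i hi, htw, one_add_vecMulVec_mulVec]
        have : i ≠ j := by grind
        simp [hxA i hi, this]
      · rw [Submonoid.coe_mul, ← mulVec_mulVec, ← hx, htw, one_add_vecMulVec_mulVec]
        have : x + x = 0 := by ext; exact CharTwo.add_self_eq_zero _
        simp [add_dotProduct, hxx', hjA, ← add_assoc, this]
    have fixed (A : orthogonalGroup ι (ZMod 2))
        (hA : ∀ i ∉ insert k s, (A : Matrix ι ι (ZMod 2)) *ᵥ Pi.single i 1 = Pi.single i 1)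
        (hAk : (A : Matrix ι ι (ZMod 2)) *ᵥ Pi.single k 1 = Pi.single k 1) : A ∈ H := by
      refine ih A fun i hi => ?_
      by_cases hik : i = k
      · rw [hik, hAk]
      · exact hA i (by grind)
    have zero (A : orthogonalGroup ι (ZMod 2))
        (hA : ∀ i ∉ insert k s, (A : Matrix ι ι (ZMod 2)) *ᵥ Pi.single i 1 = Pi.single i 1)
        (h0 : ((A : Matrix ι ι (ZMod 2)) *ᵥ Pi.single k 1) k = 0) : A ∈ H := by
      obtain ⟨t, ht, h1, h2⟩ := step A hA k (by simp) h0
      exact (H.mul_mem_cancel_left ht).1 (fixed _ h1 h2)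
    by_cases hex : ∃ j ∈ insert k s, ((A : Matrix ι ι (ZMod 2)) *ᵥ Pi.single k 1) j = 0
    · obtain ⟨j, hj, hj0⟩ := hex
      by_cases hjk : j = k
      · exact zero A hA (hjk ▸ hj0)
      · obtain ⟨t, ht, h1, h2⟩ := step A hA j hj hj0
        refine (H.mul_mem_cancel_left ht).1 (zero _ h1 ?_)
        rw [h2]
        simp [Ne.symm hjk]
    · push Not at hex
      refine fixed A hA ?_
      -- `A` fixes the indicator of `insert k s`, which is the image of `k`
      have hone : (1 : ι → ZMod 2) = (A : Matrix ι ι (ZMod 2)) *ᵥ Pi.single k 1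
          + ∑ i ∈ (insert k s)ᶜ, Pi.single i 1 := by
        ext i
        rw [Pi.add_apply, Finset.sum_apply]
        simp only [Pi.single_apply, Finset.sum_ite_eq, Finset.mem_compl]
        by_cases hi : i ∈ insert k s
        · simp [two _ (hex i hi), hi]
        · rw [hAk A hA i hi, if_pos hi, zero_add, Pi.one_apply]
      have hinj : Function.Injective ((A : Matrix ι ι (ZMod 2)) *ᵥ ·) := by
        intro x y hxy
        have := congrArg ((A : Matrix ι ι (ZMod 2))ᵀ *ᵥ ·) hxy
        simpa [mulVec_mulVec, (mem_orthogonalGroup_iff' ι (ZMod 2)).1 A.2] using this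
      apply hinj
      have h1 := orthogonal_mulVec_one A
      rw [hone, mulVec_add, mulVec_sum, Finset.sum_congr rfl
        fun i hi => hA i (Finset.mem_compl.1 hi)] at h1
      exact add_right_cancel h1

theorem eq_top_of_forall_mem_transvectionVectors {H : Subgroup (orthogonalGroup ι (ZMod 2))}
    (hH : ∀ w : ι → ZMod 2, w ⬝ᵥ w = 0 → w ∈ transvectionVectors H) : H = ⊤ :=
  eq_top_iff.2 fun A _ => mem_of_forall_mem_transvectionVectors hH Finset.univ A (by simp)

end Transvection

section SymmDiff

/-- Closure under symmetric differences of pairs of sets meeting in an odd number of points. -/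
def OddSymmDiffClosed {ι : Type*} [DecidableEq ι] (𝒮 : Set (Finset ι)) : Prop :=
  ∀ A ∈ 𝒮, ∀ B ∈ 𝒮, Odd (A ∩ B).card → symmDiff A B ∈ 𝒮

/-- A family of finite sets containing all sets with two elements. -/
def ContainsPairs {ι : Type*} [DecidableEq ι] (𝒮 : Set (Finset ι)) : Prop :=
  ∀ i j, i ≠ j → {i, j} ∈ 𝒮

variable {ι : Type*} [DecidableEq ι] {𝒮 : Set (Finset ι)}

lemma insert_erase_mem_of_odd_symmDiff
    (hodd : OddSymmDiffClosed 𝒮)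
    (hpair : ContainsPairs 𝒮) {A : Finset ι} (hA : A ∈ 𝒮) {a b : ι}
    (ha : a ∈ A) (hb : b ∉ A) : insert b (A.erase a) ∈ 𝒮 := by
  have hab : a ≠ b := by grind
  have hinter : A ∩ {a, b} = {a} := by
    ext x
    simp only [Finset.mem_inter, Finset.mem_insert, Finset.mem_singleton]
    grind
  have := hodd A hA {a, b} (hpair a b hab) (by simp [hinter])
  convert this using 1
  ext x
  simp only [Finset.mem_symmDiff, Finset.mem_insert, Finset.mem_erase, Finset.mem_singleton]
  grind

lemma mem_of_card_eq_of_odd_symmDiff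
    (hodd : OddSymmDiffClosed 𝒮)
    (hpair : ContainsPairs 𝒮) {B : Finset ι} (hB : B ∈ 𝒮) {A : Finset ι}
    (hAB : A.card = B.card) : A ∈ 𝒮 := by
  induction hm : (A \ B).card generalizing A with
  | zero =>
    have : A ⊆ B := by simpa using hm
    rwa [Finset.eq_of_subset_of_card_le this hAB.ge]
  | succ m ih =>
    obtain ⟨a, ha⟩ : (A \ B).Nonempty := by rw [← Finset.card_pos]; omega
    obtain ⟨b, hb⟩ : (B \ A).Nonempty := by
      rw [← Finset.card_pos, Finset.card_sdiff_comm hAB.symm]; omega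
    rw [Finset.mem_sdiff] at ha hb
    have hb' : b ∉ A.erase a := by grind
    have h1 : insert b (A.erase a) ∈ 𝒮 := by
      apply ih
      · rw [Finset.card_insert_of_notMem hb', Finset.card_erase_add_one ha.1, hAB]
      · have : insert b (A.erase a) \ B = (A \ B).erase a := by
          ext x
          simp only [Finset.mem_sdiff, Finset.mem_insert, Finset.mem_erase]
          clear hm hAB ih
          grind
        rw [this, Finset.card_erase_of_mem (by grind), hm, Nat.add_sub_cancel]
    have h2 := insert_erase_mem_of_odd_symmDiff hodd hpair h1 (a := b) (b := a) (by simp) (by grind)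
    convert h2 using 1
    ext x
    simp only [Finset.mem_insert, Finset.mem_erase]
    clear hm hAB ih h1 h2
    grind

/-- On a set of odd size, a family of subsets closed under symmetric differences of pairs meeting
in an odd number of points contains all nonempty even subsets as soon as it contains all pairs and
one set with four elements. -/
theorem mem_of_even_card_of_odd_symmDiff [Fintype ι] (hι : Odd (Fintype.card ι))
    (hodd : OddSymmDiffClosed 𝒮)
    (hpair : ContainsPairs 𝒮) (hfour : ∃ F ∈ 𝒮, F.card = 4) {A : Finset ι}
    (hA : Even A.card) (hne : A.Nonempty) : A ∈ 𝒮 := by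
  obtain ⟨F, hF, hF4⟩ := hfour
  have key (k : ℕ) : 2 * (k + 1) ≤ Fintype.card ι → ∃ B ∈ 𝒮, B.card = 2 * (k + 1) := by
    induction k with
    | zero =>
      intro hk
      obtain ⟨i, j, hij⟩ := Fintype.exists_pair_of_one_lt_card (by omega : 1 < Fintype.card ι)
      exact ⟨{i, j}, hpair i j hij, Finset.card_pair hij⟩
    | succ k ih =>
      intro hk
      obtain ⟨B, hB, hBk⟩ := ih (by omega)
      obtain ⟨x, hx⟩ : B.Nonempty := by rw [← Finset.card_pos]; omega
      obtain ⟨T, hT, hT3⟩ := Finset.exists_subset_card_eq (s := Bᶜ) (n := 3) (by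
        rw [Finset.card_compl]
        obtain ⟨m, hm⟩ := hι
        omega)
      have hTB (i : ι) (hi : i ∈ T) : i ∉ B := by simpa using hT hi
      have hxT : x ∉ T := fun h => hTB x h hx
      have hC : insert x T ∈ 𝒮 := mem_of_card_eq_of_odd_symmDiff hodd hpair hF
        (by rw [Finset.card_insert_of_notMem hxT, hT3, hF4])
      have hinter : B ∩ insert x T = {x} := by
        ext y
        simp only [Finset.mem_inter, Finset.mem_insert, Finset.mem_singleton]
        grind
      refine ⟨symmDiff B (insert x T), hodd B hB _ hC (by simp [hinter]), ?_⟩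
      have hunion : symmDiff B (insert x T) = B.erase x ∪ T := by
        ext y
        simp only [Finset.mem_symmDiff, Finset.mem_insert, Finset.mem_erase, Finset.mem_union]
        grind
      rw [hunion, Finset.card_union_of_disjoint, Finset.card_erase_of_mem hx, hT3, hBk]
      · omega
      · rw [Finset.disjoint_left]; grind
  obtain ⟨m, hm⟩ := hA
  have := hne.card_pos
  obtain ⟨B, hB, hBk⟩ := key (m - 1) (by have := A.card_le_univ; omega)
  exact mem_of_card_eq_of_odd_symmDiff hodd hpair hB (by omega)

lemma pair_mem_of_odd_symmDiff
    (hodd : OddSymmDiffClosed 𝒮) {a b c d e : ι} (hae : a ≠ e) (hbc : b ≠ c) (hbd : b ≠ d)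
    (hcd : c ≠ d) (ha : a ∉ ({b, c, d} : Finset ι)) (he : e ∉ ({b, c, d} : Finset ι))
    (h1 : {a, b, c, d} ∈ 𝒮) (h2 : {b, c, d, e} ∈ 𝒮) : {a, e} ∈ 𝒮 := by
  have hinter : ({a, b, c, d} ∩ {b, c, d, e} : Finset ι) = {b, c, d} := by
    ext x; simp only [Finset.mem_inter, Finset.mem_insert, Finset.mem_singleton] at *; grind
  have hcard : ({b, c, d} : Finset ι).card = 3 := Finset.card_eq_three.2
    ⟨b, c, d, hbc, hbd, hcd, rfl⟩
  have := hodd _ h1 _ h2 (by rw [hinter, hcard]; decide)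
  convert this using 1
  ext x
  simp only [Finset.mem_symmDiff, Finset.mem_insert, Finset.mem_singleton] at *; grind

lemma pair_trans_of_odd_symmDiff (hodd : OddSymmDiffClosed 𝒮) {a b c : ι} (hab : a ≠ b)
    (hbc : b ≠ c) (hac : a ≠ c) (h1 : {a, b} ∈ 𝒮) (h2 : {b, c} ∈ 𝒮) : {a, c} ∈ 𝒮 := by
  have hinter : ({a, b} ∩ {b, c} : Finset ι) = {b} := by
    ext x; simp only [Finset.mem_inter, Finset.mem_insert, Finset.mem_singleton]; grind
  have := hodd _ h1 _ h2 (by simp [hinter])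
  convert this using 1
  ext x
  simp only [Finset.mem_symmDiff, Finset.mem_insert, Finset.mem_singleton]; grind

lemma pair_mem_of_four_consecutive {n : ℕ} (hn : Odd n) (h5 : 5 ≤ n) {𝒮 : Set (Finset (ZMod n))}
    (hodd : OddSymmDiffClosed 𝒮)
    (hfour : ∀ i : ZMod n, {i, i + 1, i + 2, i + 3} ∈ 𝒮) :
    ContainsPairs 𝒮 := by
  intro i j hij
  have hne (m : ℕ) (h0 : 0 < m) (h4 : m ≤ 4) : (m : ZMod n) ≠ 0 := by
    rw [Ne, ZMod.natCast_eq_zero_iff]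
    exact fun h => by have := Nat.le_of_dvd h0 h; omega
  have h1 : (1 : ZMod n) ≠ 0 := by exact_mod_cast hne 1 (by simp) (by simp)
  have h2 : (2 : ZMod n) ≠ 0 := by exact_mod_cast hne 2 (by simp) (by simp)
  have h3 : (3 : ZMod n) ≠ 0 := by exact_mod_cast hne 3 (by simp) (by simp)
  have h4 : (4 : ZMod n) ≠ 0 := by exact_mod_cast hne 4 (by simp) (by simp)
  have hstep (i : ZMod n) : {i, i + 4} ∈ 𝒮 := by
    refine pair_mem_of_odd_symmDiff hodd ?_ ?_ ?_ ?_ ?_ ?_ (hfour i) (e := i + 4) ?_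
    · exact fun h => h4 (by linear_combination -h)
    · exact fun h => h1 (by linear_combination -h)
    · exact fun h => h2 (by linear_combination -h)
    · exact fun h => h1 (by linear_combination -h)
    · simp only [Finset.mem_insert, Finset.mem_singleton]
      rintro (h | h | h)
      · exact h1 (by linear_combination -h)
      · exact h2 (by linear_combination -h)
      · exact h3 (by linear_combination -h)
    · simp only [Finset.mem_insert, Finset.mem_singleton]
      rintro (h | h | h)
      · exact h3 (by linear_combination h)
      · exact h2 (by linear_combination h)
      · exact h1 (by linear_combination h)
    · convert hfour (i + 1) using 3 <;> ring_nf
  have hmul (k : ℕ) : i ≠ i + 4 * k → {i, i + 4 * (k : ZMod n)} ∈ 𝒮 := by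
    induction k with
    | zero => simp
    | succ k ih =>
      intro hk
      by_cases hik : i = i + 4 * k
      · convert hstep i using 3
        push_cast
        rw [mul_add, ← add_assoc, ← hik, mul_one]
      · have hs : i + 4 * ((k + 1 : ℕ) : ZMod n) = i + 4 * k + 4 := by push_cast; ring
        rw [hs] at hk ⊢
        exact pair_trans_of_odd_symmDiff hodd hik (fun h => h4 (by linear_combination -h)) hk
          (ih hik) (hstep _)
  have hunit : (4 : ZMod n) * (4 : ZMod n)⁻¹ = 1 := by
    have := ZMod.coe_mul_inv_eq_one (n := n) 4 (Nat.Coprime.pow_left 2 hn.coprime_two_left)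
    exact_mod_cast this
  have : NeZero n := ⟨by omega⟩
  have := hmul (4⁻¹ * (j - i)).val
  rw [ZMod.natCast_zmod_val, ← mul_assoc, hunit, one_mul, add_sub_cancel] at this
  exact this hij

end SymmDiff


section Generators

/-- Permutation matrices as elements of the orthogonal group. -/
def permOrthogonal (ι : Type*) [Fintype ι] [DecidableEq ι] :
    Equiv.Perm ι →* orthogonalGroup ι (ZMod 2) where
  toFun σ := ⟨permMatrixHom (R := ZMod 2) σ, by
    rw [mem_orthogonalGroup_iff, permMatrixHom_apply, transpose_permMatrix, ← permMatrix_mul,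
      inv_mul_cancel, permMatrix_one]⟩
  map_one' := Subtype.ext (map_one _)
  map_mul' σ τ := Subtype.ext (map_mul _ σ τ)

lemma permOrthogonal_mulVec {ι : Type*} [Fintype ι] [DecidableEq ι] (σ : Equiv.Perm ι)
    (w : ι → ZMod 2) :
    (permOrthogonal ι σ : Matrix ι ι (ZMod 2)) *ᵥ w = w ∘ ⇑σ⁻¹ :=
  permMatrix_mulVec _

/-- The indicator vector of a finite set, over the field with two elements. -/
def indicatorVec {ι : Type*} [DecidableEq ι] (A : Finset ι) : ι → ZMod 2 :=
  fun i => if i ∈ A then 1 else 0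

section indicatorVec

variable {ι : Type*} [DecidableEq ι]

lemma indicatorVec_add (A B : Finset ι) :
    indicatorVec A + indicatorVec B = indicatorVec (symmDiff A B) := by
  ext i
  by_cases hA : i ∈ A <;> by_cases hB : i ∈ B <;>
    simp [indicatorVec, Finset.mem_symmDiff, hA, hB, CharTwo.add_self_eq_zero]

lemma indicatorVec_dotProduct [Fintype ι] (A B : Finset ι) :
    indicatorVec A ⬝ᵥ indicatorVec B = (A ∩ B).card := by
  simp [indicatorVec, dotProduct, ← ite_and, ← Finset.mem_inter, Finset.inter_comm]

lemma indicatorVec_support [Fintype ι] (w : ι → ZMod 2) :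
    indicatorVec (Finset.univ.filter fun i => w i = 1) = w := by
  have key : ∀ a : ZMod 2, (if a = 1 then 1 else 0) = a := by decide
  ext i
  simp [indicatorVec, key]

lemma oddSymmDiffClosed_transvectionVectors [Fintype ι]
    (H : Subgroup (orthogonalGroup ι (ZMod 2))) :
    OddSymmDiffClosed {A : Finset ι | indicatorVec A ∈ transvectionVectors H} := by
  intro A hA B hB hAB
  rw [Set.mem_ofPred_eq, ← indicatorVec_add]
  exact transvectionVectors.add_mem hA hB
    (by rw [indicatorVec_dotProduct, ZMod.natCast_eq_one_iff_odd.2 hAB])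

end indicatorVec

/-- For odd `n ≥ 5` the orthogonal group over the field with two elements is generated by two
reflections whose product is the cyclic rotation of the coordinates, together with the transvection
along a vector supported on four consecutive coordinates. -/
theorem exists_involutions_closure_eq_top {n : ℕ} [NeZero n] (hn : Odd n) (h5 : 5 ≤ n) :
    ∃ R₁ R₂ R₃ : orthogonalGroup (ZMod n) (ZMod 2),
      R₁ ^ 2 = 1 ∧ R₂ ^ 2 = 1 ∧ R₃ ^ 2 = 1 ∧ (R₂ * R₁) ^ n = 1 ∧
      Subgroup.closure {R₁, R₂, R₃} = ⊤ := by
  have hne (m : ℕ) (h0 : 0 < m) (h4 : m ≤ 4) : (m : ZMod n) ≠ 0 := by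
    rw [Ne, ZMod.natCast_eq_zero_iff]
    exact fun h => by have := Nat.le_of_dvd h0 h; omega
  have h1 : (1 : ZMod n) ≠ 0 := by exact_mod_cast hne 1 (by simp) (by simp)
  have h2 : (2 : ZMod n) ≠ 0 := by exact_mod_cast hne 2 (by simp) (by simp)
  have h3 : (3 : ZMod n) ≠ 0 := by exact_mod_cast hne 3 (by simp) (by simp)
  have hcard : ({0, 1, 2, 3} : Finset (ZMod n)).card = 4 := by
    refine Finset.card_eq_succ.2 ⟨0, {1, 2, 3}, ?_, rfl, Finset.card_eq_three.2
      ⟨1, 2, 3, fun h => h1 (by linear_combination -h), fun h => h2 (by linear_combination -h),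
        fun h => h1 (by linear_combination -h), rfl⟩⟩
    simp [h1.symm, h2.symm, h3.symm]
  set v : ZMod n → ZMod 2 := indicatorVec {0, 1, 2, 3} with hv
  have hvv : v ⬝ᵥ v = 0 := by
    rw [hv, indicatorVec_dotProduct, Finset.inter_self, hcard]
    rfl
  set ρ₁ : Equiv.Perm (ZMod n) := Equiv.neg _ with hρ₁
  set ρ₂ : Equiv.Perm (ZMod n) := Equiv.subLeft 1 with hρ₂
  have hpow (k : ℕ) (i : ZMod n) : ((ρ₂ * ρ₁) ^ k) i = i + k := by
    induction k generalizing i with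
    | zero => simp
    | succ k ih =>
      rw [pow_succ, Equiv.Perm.mul_apply, ih, Equiv.Perm.mul_apply, hρ₁, hρ₂]
      simp only [Equiv.neg_apply, Equiv.subLeft_apply]
      push_cast
      ring
  refine ⟨permOrthogonal _ ρ₁, permOrthogonal _ ρ₂,
    ⟨_, one_add_vecMulVec_mem_orthogonalGroup hvv⟩, ?_, ?_, ?_, ?_, ?_⟩
  · rw [← map_pow, show ρ₁ ^ 2 = 1 by ext i; simp [hρ₁, pow_two], map_one]
  · rw [← map_pow, show ρ₂ ^ 2 = 1 by ext i; simp [hρ₂, pow_two], map_one]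
  · refine Subtype.ext ?_
    have h := (mem_orthogonalGroup_iff _ _).1 (one_add_vecMulVec_mem_orthogonalGroup hvv)
    rwa [transpose_add, transpose_one, transpose_vecMulVec, ← pow_two] at h
  · rw [← map_mul, ← map_pow, show (ρ₂ * ρ₁) ^ n = 1 by ext i; simp [hpow], map_one]
  set R₁ := permOrthogonal _ ρ₁ with hR₁
  set R₂ := permOrthogonal _ ρ₂ with hR₂
  set R₃ : orthogonalGroup (ZMod n) (ZMod 2) := ⟨_, one_add_vecMulVec_mem_orthogonalGroup hvv⟩
  set H := Subgroup.closure {R₁, R₂, R₃}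
  have hv_mem : v ∈ transvectionVectors H :=
    ⟨hvv, R₃, Subgroup.subset_closure (by simp), rfl⟩
  have hrot : permOrthogonal _ (ρ₂ * ρ₁) ∈ H := by
    rw [map_mul, ← hR₁, ← hR₂]
    exact H.mul_mem (Subgroup.subset_closure (by simp)) (Subgroup.subset_closure (by simp))
  have hodd := oddSymmDiffClosed_transvectionVectors H
  have hfour (i : ZMod n) : {i, i + 1, i + 2, i + 3} ∈
      {A : Finset (ZMod n) | indicatorVec A ∈ transvectionVectors H} := by
    have := transvectionVectors.mulVec_mem (H.pow_mem hrot i.val) hv_mem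
    rw [← map_pow, permOrthogonal_mulVec] at this
    rw [Set.mem_ofPred_eq]
    convert this using 1
    ext j
    obtain ⟨j, rfl⟩ := ((ρ₂ * ρ₁) ^ i.val).surjective j
    rw [Function.comp_apply, ← Equiv.Perm.mul_apply, inv_mul_cancel, Equiv.Perm.one_apply, hpow,
      ZMod.natCast_zmod_val, hv]
    have hshift (c : ZMod n) : j + i = i + c ↔ j = c := by rw [add_comm, add_right_inj]
    simp [indicatorVec, hshift]
  have hpair := pair_mem_of_four_consecutive hn h5 hodd hfour
  refine eq_top_of_forall_mem_transvectionVectors fun w hw => ?_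
  rw [← indicatorVec_support w] at hw ⊢
  set A := Finset.univ.filter fun i => w i = 1
  rw [indicatorVec_dotProduct, Finset.inter_self, ZMod.natCast_eq_zero_iff_even] at hw
  obtain hA | hA := A.eq_empty_or_nonempty
  · convert transvectionVectors.zero_mem
    ext i
    simp [indicatorVec, hA]
  · exact mem_of_even_card_of_odd_symmDiff (by rwa [ZMod.card]) hodd hpair
      ⟨{0, 1, 2, 3}, by exact hv_mem, hcard⟩ hw hA

end Generators

section Symplectic

lemma J_transpose_zmod_two {l : Type*} [DecidableEq l] : (J l (ZMod 2))ᵀ = J l (ZMod 2) := by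
  rw [J_transpose]
  ext
  exact CharTwo.neg_eq _

variable {l ι : Type*} [Fintype l] [DecidableEq l] [Fintype ι] [DecidableEq ι]

lemma J_mul_J_zmod_two : J l (ZMod 2) * J l (ZMod 2) = 1 := by
  rw [J_squared]
  ext
  exact CharTwo.neg_eq _

/-- A matrix `U` identifying the symplectic space with the quotient of a coordinate space of odd
dimension by the line spanned by the all-ones vector. -/
structure IsSymplecticQuotient (U : Matrix (l ⊕ l) ι (ZMod 2)) : Prop where
  mul_transpose : U * Uᵀ = J l (ZMod 2)
  mulVec_one : U *ᵥ 1 = 0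
  transpose_mul_J_mul : Uᵀ * J l (ZMod 2) * U = 1 + vecMulVec (1 : ι → ZMod 2) (1 : ι → ZMod 2)

lemma one_vecMul_orthogonal (A : orthogonalGroup ι (ZMod 2)) :
    1 ᵥ* (A : Matrix ι ι (ZMod 2)) = 1 := by
  rw [← mulVec_transpose]
  exact orthogonal_mulVec_one A⁻¹

namespace IsSymplecticQuotient

variable {U : Matrix (l ⊕ l) ι (ZMod 2)}

lemma mul_mul (hU : IsSymplecticQuotient U) (A B : orthogonalGroup ι (ZMod 2)) :
    U * (A * B : Matrix ι ι (ZMod 2)) * Uᵀ * J l (ZMod 2) =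
      (U * (A : Matrix ι ι (ZMod 2)) * Uᵀ * J l (ZMod 2)) *
        (U * (B : Matrix ι ι (ZMod 2)) * Uᵀ * J l (ZMod 2)) := by
  have h : (U * (A : Matrix ι ι (ZMod 2)) * Uᵀ * J l (ZMod 2)) *
      (U * (B : Matrix ι ι (ZMod 2)) * Uᵀ * J l (ZMod 2)) =
      U * (A : Matrix ι ι (ZMod 2)) * (Uᵀ * J l (ZMod 2) * U) * (B : Matrix ι ι (ZMod 2)) * Uᵀ
        * J l (ZMod 2) := by simp only [Matrix.mul_assoc]
  rw [h, hU.transpose_mul_J_mul, Matrix.mul_add, Matrix.add_mul,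
    Matrix.add_mul, Matrix.add_mul, mul_vecMulVec, ← mulVec_mulVec, orthogonal_mulVec_one,
    hU.mulVec_one, zero_vecMulVec]
  simp only [Matrix.zero_mul, add_zero, Matrix.mul_one, Matrix.mul_assoc]

/-- The action of the orthogonal group on the symplectic quotient. -/
def hom (hU : IsSymplecticQuotient U) :
    orthogonalGroup ι (ZMod 2) →* symplecticGroup l (ZMod 2) where
  toFun A := ⟨U * (A : Matrix ι ι (ZMod 2)) * Uᵀ * J l (ZMod 2), by
    have h1 : U * ((A * A⁻¹ : orthogonalGroup ι (ZMod 2)) : Matrix ι ι (ZMod 2)) * Uᵀ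
        * J l (ZMod 2) = 1 := by
      rw [mul_inv_cancel, Submonoid.coe_one, Matrix.mul_one, hU.mul_transpose, J_mul_J_zmod_two]
    have hinv : ((A⁻¹ : orthogonalGroup ι (ZMod 2)) : Matrix ι ι (ZMod 2)) = (A.1)ᵀ := rfl
    rw [Submonoid.coe_mul, hU.mul_mul, hinv] at h1
    have h2 := congrArg (· * J l (ZMod 2)) h1
    simp only [Matrix.mul_assoc, J_mul_J_zmod_two, Matrix.mul_one, Matrix.one_mul] at h2
    rw [SymplecticGroup.mem_iff, transpose_mul, transpose_mul, transpose_mul, transpose_transpose,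
      J_transpose_zmod_two]
    simp only [Matrix.mul_assoc]
    rw [← Matrix.mul_assoc (J l (ZMod 2)) (J l (ZMod 2)), J_mul_J_zmod_two, Matrix.one_mul]
    exact h2⟩
  map_one' := Subtype.ext <| by
    change U * 1 * Uᵀ * J l (ZMod 2) = 1
    rw [Matrix.mul_one, hU.mul_transpose, J_mul_J_zmod_two]
  map_mul' A B := Subtype.ext (hU.mul_mul A B)

lemma hom_surjective (hU : IsSymplecticQuotient U) (hι : Odd (Fintype.card ι)) :
    Function.Surjective hU.hom := by
  rintro ⟨M, hM⟩
  rw [SymplecticGroup.mem_iff] at hM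
  set N : Matrix ι ι (ZMod 2) := vecMulVec (1 : ι → ZMod 2) (1 : ι → ZMod 2) with hN_def
  have hN : N * N = N := by
    rw [hN_def, vecMulVec_mul_vecMulVec, dotProduct_self_eq_sum]
    simp [ZMod.natCast_eq_one_iff_odd.2 hι]
  have hUN : U * N = (0 : Matrix (l ⊕ l) ι (ZMod 2)) := by
    rw [hN_def, mul_vecMulVec, hU.mulVec_one, zero_vecMulVec]
  have hNU : N * Uᵀ = (0 : Matrix ι (l ⊕ l) (ZMod 2)) := by
    rw [hN_def, vecMulVec_mul, vecMul_transpose, hU.mulVec_one]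
    ext
    simp [vecMulVec_apply]
  have hU1 : Uᵀ * J l (ZMod 2) * U + N = 1 := by
    rw [hU.transpose_mul_J_mul, add_assoc]
    ext
    simp [hN_def, CharTwo.add_self_eq_zero]
  refine ⟨⟨Uᵀ * J l (ZMod 2) * M * U + N, ?_⟩, Subtype.ext ?_⟩
  · rw [mem_orthogonalGroup_iff, transpose_add, transpose_mul, transpose_mul, transpose_mul,
      transpose_transpose, J_transpose_zmod_two, hN_def, transpose_vecMulVec, ← hN_def,
      Matrix.mul_add, Matrix.add_mul, Matrix.add_mul, hN, Matrix.mul_assoc _ U N, hUN,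
      Matrix.mul_zero, zero_add, ← Matrix.mul_assoc N, hNU, Matrix.zero_mul, add_zero, ← hU1]
    congr 1
    calc _ = Uᵀ * J l (ZMod 2) * (M * (U * Uᵀ) * Mᵀ) * J l (ZMod 2) * U := by
          simp only [Matrix.mul_assoc]
      _ = _ := by
          rw [hU.mul_transpose, hM, Matrix.mul_assoc Uᵀ, J_mul_J_zmod_two, Matrix.mul_one]
  · change U * (Uᵀ * J l (ZMod 2) * M * U + N) * Uᵀ * J l (ZMod 2) = M
    rw [Matrix.mul_add, hUN, add_zero]
    calc _ = (U * Uᵀ) * J l (ZMod 2) * M * ((U * Uᵀ) * J l (ZMod 2)) := by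
          simp only [Matrix.mul_assoc]
      _ = _ := by rw [hU.mul_transpose, J_mul_J_zmod_two, Matrix.one_mul, Matrix.mul_one]

/-- In odd dimension `2 |l| + 1` the last condition of `IsSymplecticQuotient` is automatic. -/
lemma of_equiv (e : ι ≃ (l ⊕ l) ⊕ Unit) (h1 : U * Uᵀ = J l (ZMod 2)) (h2 : U *ᵥ 1 = 0)
    (hι : Odd (Fintype.card ι)) : IsSymplecticQuotient U where
  mul_transpose := h1
  mulVec_one := h2
  transpose_mul_J_mul := by
    have hX : fromRows U (replicateRow Unit 1) *
        fromCols (Uᵀ * J l (ZMod 2)) (replicateCol Unit 1) = 1 := by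
      rw [fromRows_mul_fromCols, ← Matrix.mul_assoc, ← Matrix.mul_assoc, h1, J_mul_J_zmod_two,
        ← replicateCol_mulVec, h2, ← replicateRow_vecMul, vecMul_transpose, h2]
      ext (_ | _) (_ | _) <;>
        simp [Matrix.mul_apply, Matrix.one_apply, ZMod.natCast_eq_one_iff_odd.2 hι]
    rw [mul_eq_one_comm_of_equiv e.symm] at hX
    rw [fromCols_mul_fromRows, ← vecMulVec_eq] at hX
    rw [← hX, add_assoc]
    ext
    simp [CharTwo.add_self_eq_zero]

end IsSymplecticQuotient

/-- The symplectic quotient of a coordinate space of dimension `2 * h + 1`. -/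
lemma exists_isSymplecticQuotient (h : ℕ) (e : ι ≃ (Fin h ⊕ Fin h) ⊕ Unit)
    (hι : Odd (Fintype.card ι)) :
    ∃ U : Matrix (Fin h ⊕ Fin h) ι (ZMod 2), IsSymplecticQuotient U := by
  set le : Matrix (Fin h) (Fin h) (ZMod 2) := of fun a i => if a ≤ i then 1 else 0 with hle
  set lt : Matrix (Fin h) (Fin h) (ZMod 2) := of fun a i => if a < i then 1 else 0 with hlt
  have hsum : le *ᵥ 1 + lt *ᵥ 1 = 1 := by
    ext a
    have h0 (i : Fin h) : le a i + lt a i = if a = i then 1 else 0 := by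
      have := CharTwo.add_self_eq_zero (1 : ZMod 2)
      simp only [hle, hlt, of_apply]
      grind
    simp [mulVec, dotProduct, ← Finset.sum_add_distrib, h0]
  have h1 (a b i : Fin h) : le a i * le b i + lt a i * lt b i = if i = max a b then 1 else 0 := by
    have := CharTwo.add_self_eq_zero (1 : ZMod 2)
    simp only [hle, hlt, of_apply]
    grind
  have h2 (a b i : Fin h) : le a i * lt b i + lt a i * le b i =
      if a = b then 0 else if i = max a b then 1 else 0 := by
    have := CharTwo.add_self_eq_zero (1 : ZMod 2)
    simp only [hle, hlt, of_apply]
    grind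
  have h3 : le * leᵀ + lt * ltᵀ = of fun _ _ => 1 := by
    ext a b
    simp [mul_apply, ← Finset.sum_add_distrib, h1]
  have h4 : le * ltᵀ + lt * leᵀ = 1 + of fun _ _ => 1 := by
    ext a b
    simp [mul_apply, ← Finset.sum_add_distrib, h2, Matrix.one_apply]
    have := CharTwo.add_self_eq_zero (1 : ZMod 2)
    split_ifs <;> simp [this]
  refine ⟨(fromCols (fromBlocks le lt lt le) (of fun _ _ => 1)).submatrix id e,
    .of_equiv e ?_ ?_ hι⟩
  · rw [transpose_submatrix, submatrix_mul_equiv, submatrix_id_id, transpose_fromCols,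
      fromCols_mul_fromRows, fromBlocks_transpose, fromBlocks_multiply, h3, add_comm (lt * _), h4,
      add_comm (lt * _), h3]
    have := CharTwo.add_self_eq_zero (1 : ZMod 2)
    ext (a | a) (b | b) <;> simp [J, Matrix.mul_apply, Matrix.one_apply, add_assoc, this]
  · rw [submatrix_mulVec_equiv]
    have h5 := fun a => congrFun hsum a
    simp only [mulVec, dotProduct, Pi.add_apply, Pi.one_apply, mul_one] at h5
    have := CharTwo.add_self_eq_zero (1 : ZMod 2)
    ext (a | a) <;> simp [mulVec, dotProduct, h5, add_comm (∑ _, lt _ _), this]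

end Symplectic

/-- For every natural number `h ≥ 13`, the symplectic group `Sp(2h; ℤ/2ℤ)`
is generated by three involutions `R₁, R₂, R₃` with `(R₂ * R₁) ^ (2h+1) = 1`. -/
theorem sp_three_involutions_rotation (h : ℕ) (hh : 13 ≤ h) :
    ∃ R₁ R₂ R₃ : Matrix.symplecticGroup (Fin h) (ZMod 2),
      R₁ ^ 2 = 1 ∧ R₂ ^ 2 = 1 ∧ R₃ ^ 2 = 1 ∧
      (R₂ * R₁) ^ (2 * h + 1) = 1 ∧
      Subgroup.closure ({R₁, R₂, R₃} : Set (Matrix.symplecticGroup (Fin h) (ZMod 2))) = ⊤ := by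
  have hn : Odd (2 * h + 1) := odd_two_mul_add_one h
  have hcard : Fintype.card (ZMod (2 * h + 1)) = Fintype.card ((Fin h ⊕ Fin h) ⊕ Unit) := by
    simp [ZMod.card, two_mul]
  obtain ⟨U, hU⟩ := exists_isSymplecticQuotient h (Fintype.equivOfCardEq hcard)
    (by rwa [ZMod.card])
  obtain ⟨R₁, R₂, R₃, h1, h2, h3, h4, htop⟩ := exists_involutions_closure_eq_top hn (by omega)
  refine ⟨hU.hom R₁, hU.hom R₂, hU.hom R₃, ?_, ?_, ?_, ?_, ?_⟩
  · rw [← map_pow, h1, map_one]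
  · rw [← map_pow, h2, map_one]
  · rw [← map_pow, h3, map_one]
  · rw [← map_mul, ← map_pow, h4, map_one]
  · have := congrArg (Subgroup.map hU.hom) htop
    rwa [MonoidHom.map_closure, Set.image_insert_eq, Set.image_insert_eq, Set.image_singleton,
      Subgroup.map_top_of_surjective _ (hU.hom_surjective (by rwa [ZMod.card]))] at this
end
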